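/- arXiv:1601.03628 — 5 statements merged into one kernel-verified Lean document; each statement's English description precedes it below -/
import Mathlib

section
/- Let Ω be a finite set with |Ω| = n and let k be a divisor of n, k ≥ 2, n ≥ 3k. If L is a nontrivial Cameron-Liebler class of k-sets with parameter x in Ω (i.e., L is neither empty nor the family of all k-subsets of Ω), then either x = 1 and L is the family of all k-subsets of Ω containing some fixed element p ∈ Ω, or x = n/k − 1 and L is the family of all k-subsets of Ω not containing some fixed element p ∈ Ω. -/
/-- A `k`-uniform partition of the finite ground set `α`: a family of pairwise disjoint
`k`-subsets such that every element lies in exactly one member. -/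
def IsUniformPartition {α : Type*} [Fintype α] [DecidableEq α] (k : ℕ)
    (P : Finset (Finset α)) : Prop :=
  (∀ A ∈ P, A.card = k) ∧ ∀ a : α, ∃! A, A ∈ P ∧ a ∈ A

/-- A Cameron-Liebler class of `k`-sets with parameter `x`: a family of `k`-subsets meeting
every `k`-uniform partition in exactly `x` members. -/
def IsCameronLiebler {α : Type*} [Fintype α] [DecidableEq α] (k x : ℕ)
    (L : Finset (Finset α)) : Prop :=
  (∀ A ∈ L, A.card = k) ∧
    ∀ P : Finset (Finset α), IsUniformPartition k P → (L ∩ P).card = x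

/-- A finset whose size is a multiple of `k` can be split into `k`-sets. -/
theorem exists_uniform_split {α : Type*} [DecidableEq α] (k m : ℕ) (s : Finset α)
    (hs : s.card = m * k) (hk : 0 < k) :
    ∃ P : Finset (Finset α), P.card = m ∧ (∀ A ∈ P, A.card = k ∧ A ⊆ s) ∧
      ∀ a ∈ s, ∃! A, A ∈ P ∧ a ∈ A := by
  induction m generalizing s with
  | zero =>
    have : s = ∅ := by simpa using hs
    subst this
    exact ⟨∅, by simp⟩
  | succ m ih =>
    obtain ⟨T, hTs, hT⟩ := Finset.exists_subset_card_eq (s := s) (n := k) (by rw [hs]; nlinarith)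
    obtain ⟨P, hPc, hPs, hPu⟩ := ih (s \ T) (by
      rw [Finset.card_sdiff_of_subset hTs, hs, hT, Nat.succ_mul, Nat.add_sub_cancel])
    have hmem : ∀ A ∈ P, ∀ a ∈ A, a ∈ s ∧ a ∉ T := fun A hA a ha =>
      Finset.mem_sdiff.1 ((hPs A hA).2 ha)
    have hTP : T ∉ P := fun h => by
      obtain ⟨a, ha⟩ := Finset.card_pos.1 (hT ▸ hk)
      exact (hmem T h a ha).2 ha
    refine ⟨insert T P, by rw [Finset.card_insert_of_notMem hTP, hPc], ?_, ?_⟩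
    · intro A hA
      rcases Finset.mem_insert.1 hA with rfl | hA
      · exact ⟨hT, hTs⟩
      · exact ⟨(hPs A hA).1, (hPs A hA).2.trans Finset.sdiff_subset⟩
    · intro a ha
      by_cases haT : a ∈ T
      · refine ⟨T, ⟨Finset.mem_insert_self _ _, haT⟩, ?_⟩
        rintro B ⟨hB, haB⟩
        rcases Finset.mem_insert.1 hB with rfl | hB
        · rfl
        · exact absurd haT (hmem B hB a haB).2
      · obtain ⟨A, ⟨hA, haA⟩, hu⟩ := hPu a (Finset.mem_sdiff.2 ⟨ha, haT⟩)
        refine ⟨A, ⟨Finset.mem_insert_of_mem hA, haA⟩, ?_⟩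
        rintro B ⟨hB, haB⟩
        rcases Finset.mem_insert.1 hB with rfl | hB
        · exact absurd haB haT
        · exact hu B ⟨hB, haB⟩

/-- Exchanging `a` for `b` in some `k`-set leads out of `L`. -/
def Dominates {α : Type*} [DecidableEq α] (k : ℕ) (L : Finset (Finset α)) (a b : α) :
    Prop :=
  a ≠ b ∧ ∃ S : Finset α, S.card + 1 = k ∧ a ∉ S ∧ b ∉ S ∧ insert a S ∈ L ∧ insert b S ∉ L

theorem mem_of_forall_not_dominates {α : Type*} [DecidableEq α] {k : ℕ}
    {L : Finset (Finset α)} (h : ∀ a b, ¬ Dominates k L a b) (m : ℕ)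
    {A B : Finset α}
    (hm : (A \ B).card = m) (hA : A.card = k) (hB : B.card = k) (hAL : A ∈ L) : B ∈ L := by
  induction m generalizing A with
  | zero =>
    have hs : A ⊆ B := by simpa using hm
    rwa [← Finset.eq_of_subset_of_card_le hs (by omega)]
  | succ m ih =>
    have hc : (B \ A).card = m + 1 := by
      have h₁ := Finset.card_sdiff_add_card_inter A B
      have h₂ := Finset.card_sdiff_add_card_inter B A
      rw [Finset.inter_comm] at h₂
      omega
    obtain ⟨a, ha⟩ := Finset.card_pos.1 (m.succ_pos.trans_eq hm.symm)
    obtain ⟨b, hb⟩ := Finset.card_pos.1 (m.succ_pos.trans_eq hc.symm)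
    rw [Finset.mem_sdiff] at ha hb
    have hbS : b ∉ A.erase a := fun h' => hb.2 (Finset.mem_of_mem_erase h')
    have hS : (A.erase a).card + 1 = k := by rw [Finset.card_erase_add_one ha.1, hA]
    refine ih (A := insert b (A.erase a)) ?_ (by rw [Finset.card_insert_of_notMem hbS, hS]) ?_
    · have : insert b (A.erase a) \ B = (A \ B).erase a := by
        ext c
        simp only [Finset.mem_sdiff, Finset.mem_insert, Finset.mem_erase]
        constructor
        · rintro ⟨rfl | hc, hcB⟩
          · exact absurd hb.1 hcB
          · exact ⟨hc.1, hc.2, hcB⟩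
        · rintro ⟨h₁, h₂, h₃⟩
          exact ⟨Or.inr ⟨h₁, h₂⟩, h₃⟩
      rw [this, Finset.card_erase_of_mem (Finset.mem_sdiff.2 ha), hm, Nat.add_sub_cancel]
    · by_contra hL
      exact h a b ⟨fun e => hb.2 (e ▸ ha.1), A.erase a, hS, Finset.notMem_erase a A, hbS,
        by rwa [Finset.insert_erase ha.1], hL⟩

section CameronLiebler

variable {α : Type*} [Fintype α] [DecidableEq α] {k x : ℕ} {L : Finset (Finset α)}

theorem exists_isUniformPartition (hdvd : k ∣ Fintype.card α) (hk : 0 < k) :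
    ∃ P : Finset (Finset α), P.card = Fintype.card α / k ∧ IsUniformPartition k P := by
  obtain ⟨P, hPc, hPs, hPu⟩ := exists_uniform_split k (Fintype.card α / k)
    (Finset.univ : Finset α) (by rw [Finset.card_univ, Nat.div_mul_cancel hdvd]) hk
  exact ⟨P, hPc, fun A hA => (hPs A hA).1, fun a => hPu a (Finset.mem_univ a)⟩

/-- Two disjoint `k`-sets extend to a uniform partition by a family avoiding both of them. -/
theorem isUniformPartition_insert_pair {P : Finset (Finset α)} {A B U : Finset α} (hk : 0 < k)
    (hA : A.card = k) (hB : B.card = k) (hAB : Disjoint A B) (hU : A ∪ B = U)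
    (hPs : ∀ C ∈ P, C.card = k ∧ C ⊆ Uᶜ) (hPu : ∀ a ∈ Uᶜ, ∃! C, C ∈ P ∧ a ∈ C) :
    A ∉ insert B P ∧ B ∉ P ∧ IsUniformPartition k (insert A (insert B P)) := by
  subst hU
  have hmem : ∀ C ∈ P, ∀ a ∈ C, a ∉ A ∧ a ∉ B := fun C hC a ha => by
    simpa using (hPs C hC).2 ha
  have hdis : ∀ a ∈ A, a ∉ B := fun a ha => Finset.disjoint_left.1 hAB ha
  obtain ⟨a₀, ha₀⟩ := Finset.card_pos.1 (hA ▸ hk)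
  obtain ⟨b₀, hb₀⟩ := Finset.card_pos.1 (hB ▸ hk)
  refine ⟨?_, fun h => (hmem B h b₀ hb₀).2 hb₀, ?_, ?_⟩
  · intro h
    rcases Finset.mem_insert.1 h with h | h
    · exact hdis a₀ ha₀ (h ▸ ha₀)
    · exact (hmem A h a₀ ha₀).1 ha₀
  · intro C hC
    simp only [Finset.mem_insert] at hC
    rcases hC with rfl | rfl | hC
    · exact hA
    · exact hB
    · exact (hPs C hC).1
  · intro a
    by_cases haA : a ∈ A
    · refine ⟨A, ⟨by simp, haA⟩, ?_⟩
      rintro C ⟨hC, haC⟩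
      simp only [Finset.mem_insert] at hC
      rcases hC with rfl | rfl | hC
      · rfl
      · exact absurd haC (hdis a haA)
      · exact absurd haA (hmem C hC a haC).1
    · by_cases haB : a ∈ B
      · refine ⟨B, ⟨by simp, haB⟩, ?_⟩
        rintro C ⟨hC, haC⟩
        simp only [Finset.mem_insert] at hC
        rcases hC with rfl | rfl | hC
        · exact absurd haC haA
        · rfl
        · exact absurd haB (hmem C hC a haC).2
      · obtain ⟨C, ⟨hC, haC⟩, hu⟩ := hPu a (by simp [haA, haB])
        refine ⟨C, ⟨by simp [hC], haC⟩, ?_⟩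
        rintro D ⟨hD, haD⟩
        simp only [Finset.mem_insert] at hD
        rcases hD with rfl | rfl | hD
        · exact absurd haD haA
        · exact absurd haD haB
        · exact hu D ⟨hD, haD⟩

theorem IsCameronLiebler.sum_eq (hCL : IsCameronLiebler k x L) {P : Finset (Finset α)}
    (hP : IsUniformPartition k P) : ∑ A ∈ P, (if A ∈ L then 1 else 0) = x := by
  rw [← hCL.2 P hP, Finset.inter_comm, ← Finset.filter_mem_eq_inter, Finset.card_filter]

/-- The number of members of `L` among two complementary halves of a `2k`-set depends only on
the `2k`-set. -/
theorem IsCameronLiebler.pair_eq (hCL : IsCameronLiebler k x L) (hdvd : k ∣ Fintype.card α)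
    (hk : 0 < k) {A B A' B' : Finset α} (hA : A.card = k) (hB : B.card = k)
    (hA' : A'.card = k) (hB' : B'.card = k) (hAB : Disjoint A B) (hAB' : Disjoint A' B')
    (hU : A ∪ B = A' ∪ B') :
    (if A ∈ L then 1 else 0) + (if B ∈ L then 1 else 0) =
      (if A' ∈ L then 1 else 0) + (if B' ∈ L then 1 else 0) := by
  obtain ⟨m, hm⟩ := hdvd
  have hc : (A' ∪ B')ᶜ.card = (m - 2) * k := by
    rw [Finset.card_compl, Finset.card_union_of_disjoint hAB', hA', hB', hm, Nat.sub_mul,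
      mul_comm k m, two_mul]
  obtain ⟨P, -, hPs, hPu⟩ := exists_uniform_split k (m - 2) _ hc hk
  obtain ⟨h₁, h₂, h₃⟩ := isUniformPartition_insert_pair hk hA hB hAB hU hPs hPu
  obtain ⟨h₁', h₂', h₃'⟩ := isUniformPartition_insert_pair hk hA' hB' hAB' rfl hPs hPu
  have e := hCL.sum_eq h₃
  have e' := hCL.sum_eq h₃'
  rw [Finset.sum_insert h₁, Finset.sum_insert h₂] at e
  rw [Finset.sum_insert h₁', Finset.sum_insert h₂'] at e'
  omega

theorem exists_disjoint_card_eq (U : Finset α) {r : ℕ} (h : U.card + r ≤ Fintype.card α) :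
    ∃ T : Finset α, Disjoint U T ∧ T.card = r := by
  obtain ⟨T, hT, hc⟩ := Finset.exists_subset_card_eq (s := Uᶜ) (n := r) (by
    rw [Finset.card_compl]; omega)
  exact ⟨T, Finset.disjoint_left.2 fun a ha haT => Finset.mem_compl.1 (hT haT) ha, hc⟩

theorem IsCameronLiebler.swap_of_disjoint (hCL : IsCameronLiebler k x L)
    (hdvd : k ∣ Fintype.card α) {a b : α} {S T : Finset α} (hab : a ≠ b)
    (hS : S.card + 1 = k) (hT : T.card + 1 = k) (hST : Disjoint S T)
    (haS : a ∉ S) (hbS : b ∉ S) (haT : a ∉ T) (hbT : b ∉ T)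
    (ha : insert a S ∈ L) (hb : insert b S ∉ L) : insert a T ∈ L ∧ insert b T ∉ L := by
  have h := hCL.pair_eq hdvd (by omega) (A := insert a S) (B := insert b T)
    (A' := insert b S) (B' := insert a T)
    (by rw [Finset.card_insert_of_notMem haS, hS]) (by rw [Finset.card_insert_of_notMem hbT, hT])
    (by rw [Finset.card_insert_of_notMem hbS, hS]) (by rw [Finset.card_insert_of_notMem haT, hT])
    (by simp [haT, hbS, hST, hab.symm]) (by simp [hab, hbT, haS, hST])
    (by ext c; simp only [Finset.mem_union, Finset.mem_insert]; tauto)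
  rw [if_pos ha, if_neg hb] at h
  constructor
  · by_contra h'
    rw [if_neg h'] at h
    omega
  · intro h'
    rw [if_pos h'] at h
    split_ifs at h <;> simp at h

theorem Dominates.forall_swap {a b : α} (h : Dominates k L a b) (hCL : IsCameronLiebler k x L)
    (hdvd : k ∣ Fintype.card α) (h3k : 3 * k ≤ Fintype.card α) {S : Finset α}
    (hS : S.card + 1 = k) (haS : a ∉ S) (hbS : b ∉ S) : insert a S ∈ L ∧ insert b S ∉ L := by
  obtain ⟨hab, R, hR, haR, hbR, ha, hb⟩ := h
  obtain ⟨T, hUT, hT⟩ := exists_disjoint_card_eq (insert a (insert b (R ∪ S))) (r := k - 1) (by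
    have h₁ := Finset.card_insert_le a (insert b (R ∪ S))
    have h₂ := Finset.card_insert_le b (R ∪ S)
    have h₃ := Finset.card_union_le R S
    omega)
  simp only [Finset.disjoint_insert_left, Finset.disjoint_union_left] at hUT
  obtain ⟨haT, hbT, hRT, hST⟩ := hUT
  have hT' : T.card + 1 = k := by omega
  obtain ⟨ha', hb'⟩ := hCL.swap_of_disjoint hdvd hab hR hT' hRT haR hbR haT hbT ha hb
  exact hCL.swap_of_disjoint hdvd hab hT' hS hST.symm haT hbT haS hbS ha' hb'

theorem Dominates.or {a b c : α} (h : Dominates k L a b) (hCL : IsCameronLiebler k x L)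
    (hdvd : k ∣ Fintype.card α) (h3k : 3 * k ≤ Fintype.card α) (hk2 : 2 ≤ k) (hca : c ≠ a)
    (hcb : c ≠ b) : Dominates k L a c ∨ Dominates k L c b := by
  obtain ⟨S, hUS, hS⟩ := exists_disjoint_card_eq {a, b, c} (r := k - 1) (by
    have := Finset.card_le_three (a := a) (b := b) (c := c)
    omega)
  simp only [Finset.disjoint_insert_left, Finset.disjoint_singleton_left] at hUS
  obtain ⟨haS, hbS, hcS⟩ := hUS
  have hS' : S.card + 1 = k := by omega
  obtain ⟨ha, hb⟩ := h.forall_swap hCL hdvd h3k hS' haS hbS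
  by_cases hc : insert c S ∈ L
  · exact Or.inr ⟨hcb, S, hS', hcS, hbS, hc, hb⟩
  · exact Or.inl ⟨hca.symm, S, hS', haS, hcS, ha, hc⟩

theorem Dominates.top_or_bot {a b : α} (h : Dominates k L a b) (hCL : IsCameronLiebler k x L)
    (hdvd : k ∣ Fintype.card α) (h3k : 3 * k ≤ Fintype.card α) (hk2 : 2 ≤ k) :
    (∀ c, c ≠ a → Dominates k L a c) ∨ (∀ c, c ≠ b → Dominates k L c b) := by
  by_contra! hcon
  obtain ⟨⟨c, hca, hac⟩, d, hdb, hnd⟩ := hcon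
  have hcb : c ≠ b := by rintro rfl; exact hac h
  have hda : d ≠ a := by rintro rfl; exact hnd h
  have hc : Dominates k L c b := (h.or hCL hdvd h3k hk2 hca hcb).resolve_left hac
  have hdc : d ≠ c := by rintro rfl; exact hnd hc
  have hcd : Dominates k L c d := (hc.or hCL hdvd h3k hk2 hdc hdb).resolve_right hnd
  obtain ⟨S, hUS, hS⟩ := exists_disjoint_card_eq {a, b, c, d} (r := k - 2) (by
    have := Finset.card_le_four (a := a) (b := b) (c := c) (d := d)
    omega)
  simp only [Finset.disjoint_insert_left, Finset.disjoint_singleton_left] at hUS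
  obtain ⟨haS, hbS, hcS, hdS⟩ := hUS
  have h₁ := (hcd.forall_swap hCL hdvd h3k (S := insert b S)
    (by rw [Finset.card_insert_of_notMem hbS]; omega) (by simp [hcb, hcS]) (by simp [hdb, hdS])).1
  have h₂ := (h.forall_swap hCL hdvd h3k (S := insert c S)
    (by rw [Finset.card_insert_of_notMem hcS]; omega) (by simp [hca.symm, haS])
    (by simp [hcb.symm, hbS])).2
  rw [Finset.insert_comm] at h₁
  exact h₂ h₁

/-- Every `k`-set differs from some `k`-set by an exchange with `p`. -/
theorem exists_swap_decomposition (hlt : k < Fintype.card α) (hk : 0 < k) (p : α) {A : Finset α}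
    (hA : A.card = k) :
    ∃ c, c ≠ p ∧ ∃ S : Finset α, S.card + 1 = k ∧ p ∉ S ∧ c ∉ S ∧
      (p ∈ A ∧ A = insert p S ∨ p ∉ A ∧ A = insert c S) := by
  by_cases hp : p ∈ A
  · obtain ⟨c, hc⟩ := Finset.card_pos.1 (show 0 < Aᶜ.card by rw [Finset.card_compl]; omega)
    rw [Finset.mem_compl] at hc
    exact ⟨c, fun e => hc (e ▸ hp), A.erase p, by rw [Finset.card_erase_add_one hp, hA],
      Finset.notMem_erase p A, fun h => hc (Finset.mem_of_mem_erase h),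
      Or.inl ⟨hp, (Finset.insert_erase hp).symm⟩⟩
  · obtain ⟨c, hc⟩ := Finset.card_pos.1 (hA ▸ hk)
    exact ⟨c, fun e => hp (e ▸ hc), A.erase c, by rw [Finset.card_erase_add_one hc, hA],
      fun h => hp (Finset.mem_of_mem_erase h), Finset.notMem_erase c A,
      Or.inr ⟨hp, (Finset.insert_erase hc).symm⟩⟩

end CameronLiebler

theorem stmt_0 {α : Type*} [Fintype α] [DecidableEq α] {n k x : ℕ}
    (hn : Fintype.card α = n) (hdvd : k ∣ n) (hk2 : 2 ≤ k) (h3k : 3 * k ≤ n)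
    (L : Finset (Finset α)) (hCL : IsCameronLiebler k x L)
    (hne : L ≠ ∅) (hnall : L ≠ Finset.powersetCard k Finset.univ) :
    (x = 1 ∧ ∃ p : α, L = (Finset.powersetCard k Finset.univ).filter (fun A => p ∈ A)) ∨
    (x = n / k - 1 ∧
      ∃ p : α, L = (Finset.powersetCard k Finset.univ).filter (fun A => p ∉ A)) := by
  subst hn
  have hk : 0 < k := by omega
  have hex : ∃ a b, Dominates k L a b := by
    by_contra! h
    obtain ⟨A, hA⟩ := Finset.nonempty_iff_ne_empty.2 hne
    refine hnall (Finset.Subset.antisymm (fun B hB => ?_) fun B hB => ?_)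
    · simp [hCL.1 B hB]
    · exact mem_of_forall_not_dominates h _ rfl (hCL.1 A hA) (Finset.mem_powersetCard.1 hB).2 hA
  obtain ⟨a, b, hab⟩ := hex
  obtain ⟨P, hPc, hP⟩ := exists_isUniformPartition hdvd hk
  rcases hab.top_or_bot hCL hdvd h3k hk2 with h | h
  · have hL : L = (Finset.powersetCard k Finset.univ).filter (fun A => a ∈ A) := by
      ext A
      simp only [Finset.mem_filter, Finset.mem_powersetCard_univ]
      refine ⟨fun hA => ⟨hCL.1 A hA, ?_⟩, fun ⟨hA, ha⟩ => ?_⟩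
      · obtain ⟨c, hc, S, hS, haS, hcS, ⟨h₁, h₂⟩ | ⟨h₁, h₂⟩⟩ :=
          exists_swap_decomposition (by omega) hk a (hCL.1 A hA)
        · exact h₁
        · exact absurd (h₂ ▸ hA) ((h c hc).forall_swap hCL hdvd h3k hS haS hcS).2
      · obtain ⟨c, hc, S, hS, haS, hcS, ⟨h₁, h₂⟩ | ⟨h₁, h₂⟩⟩ :=
          exists_swap_decomposition (by omega) hk a hA
        · exact h₂ ▸ ((h c hc).forall_swap hCL hdvd h3k hS haS hcS).1
        · exact absurd ha h₁
    refine Or.inl ⟨?_, a, hL⟩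
    obtain ⟨A, ⟨hA, haA⟩, hu⟩ := hP.2 a
    rw [← hCL.2 P hP, Finset.card_eq_one]
    refine ⟨A, Finset.ext fun B => ?_⟩
    simp only [hL, Finset.mem_inter, Finset.mem_filter, Finset.mem_powersetCard_univ,
      Finset.mem_singleton]
    constructor
    · rintro ⟨⟨-, haB⟩, hB⟩
      exact hu B ⟨hB, haB⟩
    · rintro rfl
      exact ⟨⟨hP.1 _ hA, haA⟩, hA⟩
  · have hL : L = (Finset.powersetCard k Finset.univ).filter (fun A => b ∉ A) := by
      ext A
      simp only [Finset.mem_filter, Finset.mem_powersetCard_univ]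
      refine ⟨fun hA => ⟨hCL.1 A hA, ?_⟩, fun ⟨hA, hb⟩ => ?_⟩
      · obtain ⟨c, hc, S, hS, hbS, hcS, ⟨h₁, h₂⟩ | ⟨h₁, h₂⟩⟩ :=
          exists_swap_decomposition (by omega) hk b (hCL.1 A hA)
        · exact absurd (h₂ ▸ hA) ((h c hc).forall_swap hCL hdvd h3k hS hcS hbS).2
        · exact h₁
      · obtain ⟨c, hc, S, hS, hbS, hcS, ⟨h₁, h₂⟩ | ⟨h₁, h₂⟩⟩ :=
          exists_swap_decomposition (by omega) hk b hA
        · exact absurd h₁ hb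
        · exact h₂ ▸ ((h c hc).forall_swap hCL hdvd h3k hS hcS hbS).1
    refine Or.inr ⟨?_, b, hL⟩
    obtain ⟨A, ⟨hA, hbA⟩, hu⟩ := hP.2 b
    rw [← hCL.2 P hP, ← hPc, ← Finset.card_erase_of_mem hA]
    congr 1
    ext B
    simp only [hL, Finset.mem_inter, Finset.mem_filter, Finset.mem_powersetCard_univ,
      Finset.mem_erase]
    constructor
    · rintro ⟨⟨-, hbB⟩, hB⟩
      exact ⟨fun e => hbB (e ▸ hbA), hB⟩
    · rintro ⟨hne', hB⟩
      exact ⟨⟨hP.1 B hB, fun hbB => hne' (hu B ⟨hB, hbB⟩)⟩, hB⟩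
end

section
/- Let Ω be a finite set with |Ω| = n, let k be a divisor of n with k ≥ 1, let L be a family of k-subsets of Ω, and set x = |L| / C(n−1, k−1) (as a rational number). Then L is a Cameron-Liebler class of k-sets with parameter x in Ω if and only if for every k-subset π of Ω, the number of members of L disjoint from π equals (x − χ(π)) · C(n−k−1, k−1), where χ(π) = 1 if π ∈ L and χ(π) = 0 otherwise. -/
/-- A Cameron-Liebler class of `k`-sets with (rational) parameter `x`: a family of
`k`-subsets meeting every `k`-uniform partition in exactly `x` members. -/
def IsCameronLieblerQ {α : Type*} [Fintype α] [DecidableEq α] (k : ℕ) (x : ℚ)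
    (L : Finset (Finset α)) : Prop :=
  (∀ A ∈ L, A.card = k) ∧
    ∀ P : Finset (Finset α), IsUniformPartition k P → ((L ∩ P).card : ℚ) = x

open Finset

theorem exists_perm_comp_eq {α : Type*} [Fintype α] {β : Type*} [DecidableEq β] {f g : α → β}
    (h : ∀ b, #{a | f a = b} = #{a | g a = b}) : ∃ σ : Equiv.Perm α, ∀ a, g (σ a) = f a := by
  have e (b : β) : {a // f a = b} ≃ {a // g a = b} :=
    Fintype.equivOfCardEq (by simpa [Fintype.card_subtype] using h b)
  refine ⟨(Equiv.sigmaFiberEquiv f).symm.trans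
    ((Equiv.sigmaCongrRight e).trans (Equiv.sigmaFiberEquiv g)), fun a => ?_⟩
  exact (e (f a) ⟨a, rfl⟩).2

theorem card_powersetCard_filter_mem {α : Type*} [DecidableEq α] {k : ℕ}
    {s : Finset α} {a : α} (ha : a ∈ s) (hk : 1 ≤ k) :
    #{B ∈ powersetCard k s | a ∈ B} = (#s - 1).choose (k - 1) := by
  rw [← card_erase_of_mem ha, ← card_powersetCard]
  refine card_nbij' (fun B => B.erase a) (fun B => insert a B) ?_ ?_ ?_ ?_
  · intro B hB
    simp only [coe_filter, mem_powersetCard, Set.mem_ofPred_eq, mem_coe] at hB ⊢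
    exact ⟨erase_subset_erase _ hB.1.1, by rw [card_erase_of_mem hB.2, hB.1.2]⟩
  · intro B hB
    simp only [coe_filter, mem_powersetCard, Set.mem_ofPred_eq, mem_coe] at hB ⊢
    have haB : a ∉ B := fun h => by simpa using hB.1 h
    refine ⟨⟨insert_subset ha (hB.1.trans (erase_subset _ _)), ?_⟩, mem_insert_self _ _⟩
    rw [card_insert_of_notMem haB]
    omega
  · intro B hB
    simp only [coe_filter, Set.mem_ofPred_eq] at hB
    exact insert_erase hB.2
  · intro B hB
    simp only [mem_powersetCard, mem_coe] at hB
    exact erase_insert fun h => by simpa using hB.1 h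

theorem sum_card_inter_eq_sum_card_filter_mem {α : Type*} [DecidableEq α]
    (Q : Finset (Finset (Finset α))) (L : Finset (Finset α)) :
    ∑ P ∈ Q, #(L ∩ P) = ∑ A ∈ L, #{P ∈ Q | A ∈ P} := by
  simpa only [bipartiteAbove, bipartiteBelow, filter_mem_eq_inter] using
    sum_card_bipartiteAbove_eq_sum_card_bipartiteBelow (s := Q) (t := L) (fun P B => B ∈ P)

theorem sum_card_inter_sq {α : Type*} [DecidableEq α]
    (Q : Finset (Finset (Finset α))) (L : Finset (Finset α)) :
    ∑ P ∈ Q, #(L ∩ P) ^ 2 = ∑ A ∈ L, ∑ P ∈ Q with A ∈ P, #(L ∩ P) := by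
  simp_rw [sum_filter]
  rw [sum_comm]
  refine sum_congr rfl fun P _ => ?_
  rw [← sum_filter, filter_mem_eq_inter, sum_const, smul_eq_mul, sq]

/-- The `k`-uniform partitions of `α`. -/
noncomputable def uniformPartitions (α : Type*) [Fintype α] [DecidableEq α] (k : ℕ) :
    Finset (Finset (Finset α)) :=
  open Classical in univ.filter (IsUniformPartition k)

section

variable {α : Type*} [Fintype α] [DecidableEq α] {k : ℕ}

theorem mem_uniformPartitions {P : Finset (Finset α)} :
    P ∈ uniformPartitions α k ↔ IsUniformPartition k P := by
  simp [uniformPartitions]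

theorem IsUniformPartition.eq_of_mem {P : Finset (Finset α)} (hP : IsUniformPartition k P)
    {A B : Finset α} (hA : A ∈ P) (hB : B ∈ P) {a : α} (haA : a ∈ A) (haB : a ∈ B) : A = B :=
  (hP.2 a).unique ⟨hA, haA⟩ ⟨hB, haB⟩

theorem IsUniformPartition.disjoint {P : Finset (Finset α)} (hP : IsUniformPartition k P)
    {A B : Finset α} (hA : A ∈ P) (hB : B ∈ P) (hAB : A ≠ B) : Disjoint A B :=
  Finset.disjoint_left.2 fun _ haA haB => hAB (hP.eq_of_mem hA hB haA haB)

theorem IsUniformPartition.image {P : Finset (Finset α)} (hP : IsUniformPartition k P)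
    (σ : Equiv.Perm α) : IsUniformPartition k (P.image (Finset.image σ)) := by
  refine ⟨?_, fun a => ?_⟩
  · intro A hA
    obtain ⟨B, hB, rfl⟩ := mem_image.1 hA
    rw [card_image_of_injective _ σ.injective, hP.1 B hB]
  · obtain ⟨A, ⟨hA, haA⟩, -⟩ := hP.2 (σ.symm a)
    refine ⟨A.image σ, ⟨mem_image_of_mem _ hA, mem_image.2 ⟨_, haA, by simp⟩⟩, ?_⟩
    rintro _ ⟨hB, haB⟩
    obtain ⟨B, hBP, rfl⟩ := mem_image.1 hB
    obtain ⟨b, hb, rfl⟩ := mem_image.1 haB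
    rw [hP.eq_of_mem hA hBP haA (by simpa using hb)]

theorem uniformPartitions_nonempty (h : k ∣ Fintype.card α) :
    (uniformPartitions α k).Nonempty := by
  obtain ⟨m, hm⟩ := h
  have e : α ≃ Fin m × Fin k := Fintype.equivOfCardEq (by simp [hm, mul_comm])
  refine ⟨univ.image fun i : Fin m => univ.filter fun a => (e a).1 = i,
    mem_uniformPartitions.2 ⟨?_, fun a => ?_⟩⟩
  · intro A hA
    obtain ⟨i, -, rfl⟩ := mem_image.1 hA
    have : (univ.filter fun a => (e a).1 = i) =
        (univ : Finset (Fin k)).image fun j => e.symm (i, j) := by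
      ext a
      simp only [mem_filter, mem_univ, true_and, mem_image]
      constructor
      · rintro rfl
        exact ⟨(e a).2, by simp⟩
      · rintro ⟨j, rfl⟩
        simp
    rw [this, card_image_of_injective _ fun j j' hj => by simpa using hj]
    simp
  · refine ⟨univ.filter fun b => (e b).1 = (e a).1, by simp, ?_⟩
    rintro _ ⟨hB, haB⟩
    obtain ⟨i, -, rfl⟩ := mem_image.1 hB
    have : (e a).1 = i := by simpa using haB
    rw [this]

theorem exists_perm_image_eq {A B A' B' : Finset α} (hAB : Disjoint A B) (hAB' : Disjoint A' B')
    (hA : #A = #A') (hB : #B = #B') :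
    ∃ σ : Equiv.Perm α, A.image σ = A' ∧ B.image σ = B' := by
  let f (A B : Finset α) (a : α) : Fin 3 := if a ∈ A then 0 else if a ∈ B then 1 else 2
  have f0 (A B : Finset α) (a : α) : f A B a = 0 ↔ a ∈ A := by grind
  have f1 {A B : Finset α} (h : Disjoint A B) (a : α) : f A B a = 1 ↔ a ∈ B := by
    have := @Finset.disjoint_left _ A B
    grind
  have f2 (A B : Finset α) (a : α) : f A B a = 2 ↔ a ∈ (A ∪ B)ᶜ := by
    simp only [f, mem_compl, mem_union]
    split_ifs <;> simp_all
  obtain ⟨σ, hσ⟩ := exists_perm_comp_eq (f := f A B) (g := f A' B') (by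
    intro b
    fin_cases b
    · simpa [f0] using hA
    · simpa [f1 hAB, f1 hAB'] using hB
    · simp only [Fin.reduceFinMk, f2, filter_univ_mem, card_compl, card_union_of_disjoint hAB,
        card_union_of_disjoint hAB', hA, hB])
  refine ⟨σ, ?_, ?_⟩
  · refine eq_of_subset_of_card_le ?_ (by rw [card_image_of_injective _ σ.injective, hA])
    intro a ha
    obtain ⟨b, hb, rfl⟩ := mem_image.1 ha
    rwa [← f0 A' B', hσ, f0]
  · refine eq_of_subset_of_card_le ?_ (by rw [card_image_of_injective _ σ.injective, hB])
    intro a ha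
    obtain ⟨b, hb, rfl⟩ := mem_image.1 ha
    rwa [← f1 hAB', hσ, f1 hAB]

theorem card_uniformPartitions_image_le (σ : Equiv.Perm α) (S : Finset (Finset α)) :
    #{P ∈ uniformPartitions α k | S ⊆ P} ≤
      #{P ∈ uniformPartitions α k | S.image (Finset.image σ) ⊆ P} := by
  refine card_le_card_of_injOn (Finset.image (Finset.image σ)) ?_
    ((image_injective (image_injective σ.injective)).injOn)
  intro P hP
  simp only [coe_filter, Set.mem_ofPred_eq, mem_uniformPartitions] at hP ⊢
  exact ⟨hP.1.image σ, image_subset_image hP.2⟩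

theorem card_uniformPartitions_pair_le {A B A' B' : Finset α} (hAB : Disjoint A B)
    (hAB' : Disjoint A' B') (hA : #A = #A') (hB : #B = #B') :
    #{P ∈ uniformPartitions α k | A ∈ P ∧ B ∈ P} ≤
      #{P ∈ uniformPartitions α k | A' ∈ P ∧ B' ∈ P} := by
  obtain ⟨σ, rfl, rfl⟩ := exists_perm_image_eq hAB hAB' hA hB
  simpa [insert_subset_iff] using card_uniformPartitions_image_le (k := k) σ {A, B}

theorem card_uniformPartitions_pair_eq {A B A' B' : Finset α} (hAB : Disjoint A B)
    (hAB' : Disjoint A' B') (hA : #A = #A') (hB : #B = #B') :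
    #{P ∈ uniformPartitions α k | A ∈ P ∧ B ∈ P} =
      #{P ∈ uniformPartitions α k | A' ∈ P ∧ B' ∈ P} :=
  (card_uniformPartitions_pair_le hAB hAB' hA hB).antisymm
    (card_uniformPartitions_pair_le hAB' hAB hA.symm hB.symm)

theorem card_uniformPartitions_mem_le {A A' : Finset α} (hA : #A = #A') :
    #{P ∈ uniformPartitions α k | A ∈ P} ≤ #{P ∈ uniformPartitions α k | A' ∈ P} := by
  obtain ⟨σ, rfl, -⟩ := exists_perm_image_eq (disjoint_empty_right A) (disjoint_empty_right A')
    hA rfl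
  simpa using card_uniformPartitions_image_le (k := k) σ {A}

theorem card_uniformPartitions_mem_eq {A A' : Finset α} (hA : #A = #A') :
    #{P ∈ uniformPartitions α k | A ∈ P} = #{P ∈ uniformPartitions α k | A' ∈ P} :=
  (card_uniformPartitions_mem_le hA).antisymm (card_uniformPartitions_mem_le hA.symm)

/-- Double counting the pairs `B ∈ P` with `a ∈ B`, for `P` in a family `Q` of uniform partitions
whose member through `a` is always contained in `s`. -/
theorem card_eq_choose_mul {Q : Finset (Finset (Finset α))} {s : Finset α} {a : α} {c : ℕ}
    (hk : 1 ≤ k) (ha : a ∈ s)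
    (hQ : ∀ P ∈ Q, IsUniformPartition k P ∧ ∀ B ∈ P, a ∈ B → B ⊆ s)
    (hc : ∀ B ⊆ s, #B = k → #{P ∈ Q | B ∈ P} = c) :
    #Q = (#s - 1).choose (k - 1) * c := by
  have h := sum_card_bipartiteAbove_eq_sum_card_bipartiteBelow (s := Q)
    (t := {B ∈ powersetCard k s | a ∈ B}) (fun P B => B ∈ P)
  rw [sum_congr rfl (g := fun _ => 1) ?_, sum_congr (s₁ := {B ∈ powersetCard k s | a ∈ B}) rfl
    (g := fun _ => c) ?_] at h
  · simpa [card_powersetCard_filter_mem ha hk] using h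
  · intro B hB
    simp only [mem_filter, mem_powersetCard] at hB
    exact hc B hB.1.1 hB.1.2
  · intro P hP
    obtain ⟨hPu, hPs⟩ := hQ P hP
    obtain ⟨B, ⟨hB, haB⟩, huniq⟩ := hPu.2 a
    refine card_eq_one.2 ⟨B, ?_⟩
    ext C
    simp only [bipartiteAbove, mem_filter, mem_powersetCard, mem_singleton]
    constructor
    · rintro ⟨⟨-, haC⟩, hC⟩
      exact huniq C ⟨hC, haC⟩
    · rintro rfl
      exact ⟨⟨⟨hPs _ hB haB, hPu.1 _ hB⟩, haB⟩, hB⟩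

theorem card_uniformPartitions_eq [Nonempty α] (hk : 1 ≤ k) {A : Finset α} (hA : #A = k) :
    #(uniformPartitions α k) = (Fintype.card α - 1).choose (k - 1) *
      #{P ∈ uniformPartitions α k | A ∈ P} :=
  card_eq_choose_mul (s := univ) hk (mem_univ (Classical.arbitrary α))
    (fun _ hP => ⟨mem_uniformPartitions.1 hP, fun _ _ _ => subset_univ _⟩)
    fun _ _ hB => card_uniformPartitions_mem_eq (hB.trans hA.symm)

theorem card_uniformPartitions_mem_eq_choose_mul (hk : 1 ≤ k) {A B : Finset α} (hA : #A = k)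
    (hB : #B = k) (hAB : Disjoint A B) :
    #{P ∈ uniformPartitions α k | A ∈ P} = (Fintype.card α - k - 1).choose (k - 1) *
      #{P ∈ uniformPartitions α k | A ∈ P ∧ B ∈ P} := by
  obtain ⟨b, hb⟩ : B.Nonempty := card_pos.1 (by omega)
  have hbA : b ∉ A := Finset.disjoint_right.1 hAB hb
  rw [← hA, ← card_compl, hA]
  refine card_eq_choose_mul hk (mem_compl.2 hbA) ?_ ?_
  · intro P hP
    rw [mem_filter, mem_uniformPartitions] at hP
    refine ⟨hP.1, fun C hC hbC => ?_⟩
    rw [subset_compl_iff_disjoint_right]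
    exact hP.1.disjoint hC hP.2 (by rintro rfl; exact hbA hbC)
  · intro C hC hCk
    rw [filter_filter]
    exact card_uniformPartitions_pair_eq (subset_compl_iff_disjoint_left.1 hC) hAB rfl
      (hCk.trans hB.symm)

theorem sum_card_inter_of_mem {L : Finset (Finset α)} {A : Finset α} (hk : 1 ≤ k)
    (hA : #A = k) {c : ℕ} (hc : ∀ B ∈ L, Disjoint B A →
      #{P ∈ uniformPartitions α k | A ∈ P ∧ B ∈ P} = c) :
    ∑ P ∈ uniformPartitions α k with A ∈ P, #(L ∩ P) =
      (if A ∈ L then #{P ∈ uniformPartitions α k | A ∈ P} else 0) +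
        #{B ∈ L | Disjoint B A} * c := by
  rw [sum_card_inter_eq_sum_card_filter_mem, ← sum_filter_add_sum_filter_not L (fun B => B = A)]
  congr 1
  · rw [filter_eq', ← sum_ite_eq' L A fun A => #{P ∈ uniformPartitions α k | A ∈ P}]
    split_ifs with h <;> simp [h, filter_filter]
  · rw [← smul_eq_mul, ← sum_const]
    symm
    refine sum_subset_zero_on_sdiff ?_ ?_ ?_
    · intro B hB
      rw [mem_filter] at hB ⊢
      refine ⟨hB.1, ?_⟩
      rintro rfl
      have := disjoint_self_iff_empty _ |>.1 hB.2
      simp [this] at hA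
      omega
    · intro B hB
      simp only [mem_sdiff, mem_filter, not_and] at hB
      rw [filter_filter, card_eq_zero, filter_eq_empty_iff]
      rintro P hP ⟨hAP, hBP⟩
      exact hB.2 hB.1.1 ((mem_uniformPartitions.1 hP).disjoint hBP hAP hB.1.2)
    · intro B hB
      rw [mem_filter] at hB
      rw [filter_filter, hc B hB.1 hB.2]

/-- The case of at least two blocks, where `A₀` and `B₀` are disjoint `k`-subsets. -/
theorem isCameronLieblerQ_iff_of_disjoint (hdvd : k ∣ Fintype.card α) (hk : 1 ≤ k)
    {A₀ B₀ : Finset α} (hA₀ : #A₀ = k) (hB₀ : #B₀ = k) (hAB₀ : Disjoint A₀ B₀)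
    {L : Finset (Finset α)} (hL : ∀ A ∈ L, #A = k) {x : ℚ}
    (hx : x = #L / ((Fintype.card α - 1).choose (k - 1) : ℚ)) :
    IsCameronLieblerQ k x L ↔
      ∀ π : Finset α, #π = k →
        (#{A ∈ L | Disjoint A π} : ℚ) =
          (x - if π ∈ L then 1 else 0) * ((Fintype.card α - k - 1).choose (k - 1) : ℚ) := by
  have : Nonempty α := ⟨(card_pos.1 (by omega : 0 < #A₀)).choose⟩
  set N := #(uniformPartitions α k) with hN
  set c₁ := #{P ∈ uniformPartitions α k | A₀ ∈ P} with hc₁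
  set c₂ := #{P ∈ uniformPartitions α k | A₀ ∈ P ∧ B₀ ∈ P} with hc₂
  set C := (Fintype.card α - 1).choose (k - 1)
  set D := (Fintype.card α - k - 1).choose (k - 1)
  have hN0 : N ≠ 0 := (card_pos.2 (uniformPartitions_nonempty hdvd)).ne'
  have hNC : N = C * c₁ := card_uniformPartitions_eq hk hA₀
  have hc₁D : c₁ = D * c₂ := card_uniformPartitions_mem_eq_choose_mul hk hA₀ hB₀ hAB₀
  have hC0 : C ≠ 0 := by rintro h; simp [h] at hNC; omega
  have hc₂0 : c₂ ≠ 0 := by rintro h; simp [h] at hc₁D; simp [hc₁D] at hNC; omega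
  have hmem (A : Finset α) (hA : #A = k) : #{P ∈ uniformPartitions α k | A ∈ P} = c₁ :=
    card_uniformPartitions_mem_eq (hA.trans hA₀.symm)
  have hLx : (#L : ℚ) = x * C := by
    rw [hx]; field_simp
  have hsum (A : Finset α) (hA : #A = k) :
      ∑ P ∈ uniformPartitions α k with A ∈ P, (#(L ∩ P) : ℚ) =
        (if A ∈ L then 1 else 0) * c₁ + #{B ∈ L | Disjoint B A} * c₂ := by
    have := sum_card_inter_of_mem (L := L) (c := c₂) hk hA fun B hB hBA =>
      card_uniformPartitions_pair_eq hBA.symm hAB₀ (hA.trans hA₀.symm) ((hL B hB).trans hB₀.symm)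
    rw [hmem A hA] at this
    rw [← Nat.cast_sum, this]
    split_ifs <;> push_cast <;> ring
  have hc₁D' : (c₁ : ℚ) = D * c₂ := by exact_mod_cast hc₁D
  have hNC' : (N : ℚ) = C * c₁ := by exact_mod_cast hNC
  constructor
  · intro h π hπ
    have h₁ := hsum π hπ
    rw [sum_congr rfl fun P hP => h.2 P (mem_uniformPartitions.1 (mem_filter.1 hP).1),
      sum_const, hmem π hπ, nsmul_eq_mul, hc₁D'] at h₁
    have : (c₂ : ℚ) ≠ 0 := by exact_mod_cast hc₂0
    apply mul_right_cancel₀ this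
    linear_combination -h₁
  · intro h
    refine ⟨hL, fun P hP => ?_⟩
    have hfirst : ∑ P ∈ uniformPartitions α k, (#(L ∩ P) : ℚ) = #L * c₁ := by
      rw [← Nat.cast_sum, sum_card_inter_eq_sum_card_filter_mem,
        sum_congr rfl fun A hA => hmem A (hL A hA)]
      simp
    have hsecond : ∑ P ∈ uniformPartitions α k, (#(L ∩ P) : ℚ) ^ 2 = #L * (x * c₁) := by
      have := sum_card_inter_sq (uniformPartitions α k) L
      rw [← @Nat.cast_inj ℚ] at this
      push_cast at this
      rw [this, ← nsmul_eq_mul, ← sum_const]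
      refine sum_congr rfl fun A hA => ?_
      rw [hsum A (hL A hA), h A (hL A hA), if_pos hA, hc₁D']
      ring
    have hvar : ∑ P ∈ uniformPartitions α k, ((#(L ∩ P) : ℚ) - x) ^ 2 = 0 := by
      simp_rw [sub_sq, sum_add_distrib, sum_sub_distrib, mul_assoc, ← mul_sum, ← sum_mul]
      rw [hsecond, hfirst, sum_const, ← hN, nsmul_eq_mul, hNC', hLx]
      ring
    have := (sum_eq_zero_iff_of_nonneg fun P _ => sq_nonneg _).1 hvar P
      (mem_uniformPartitions.2 hP)
    exact sub_eq_zero.1 (pow_eq_zero_iff two_ne_zero |>.1 this)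

end

theorem stmt_6 {α : Type*} [Fintype α] [DecidableEq α] {n k : ℕ}
    (hn : Fintype.card α = n) (hdvd : k ∣ n) (hk1 : 1 ≤ k)
    (L : Finset (Finset α)) (hL : ∀ A ∈ L, A.card = k)
    (x : ℚ) (hx : x = (L.card : ℚ) / ((n - 1).choose (k - 1) : ℚ)) :
    IsCameronLieblerQ k x L ↔
      ∀ π : Finset α, π.card = k →
        ((L.filter fun A => Disjoint A π).card : ℚ) =
          (x - if π ∈ L then 1 else 0) * ((n - k - 1).choose (k - 1) : ℚ) := by
  subst hn
  obtain h0 | hpos := Nat.eq_zero_or_pos (Fintype.card α)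
  · have hcard (A : Finset α) : #A ≠ k := by have := card_le_univ A; omega
    obtain rfl : L = ∅ := eq_empty_of_forall_notMem fun A hA => hcard A (hL A hA)
    simp [IsCameronLieblerQ, hx, hcard]
  obtain hk | hk := (Nat.le_of_dvd hpos hdvd).eq_or_lt
  · have huniv {A : Finset α} (hA : #A = k) : A = univ := card_eq_iff_eq_univ A |>.1 (hA.trans hk)
    have : Nonempty α := Fintype.card_pos_iff.1 hpos
    have hxL : x = #L := by simp [hx, ← hk]
    refine iff_of_true ⟨hL, fun P hP => ?_⟩ fun π hπ => ?_
    · obtain ⟨A, ⟨hA, -⟩, -⟩ := hP.2 (Classical.arbitrary α)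
      rw [inter_eq_left.2, hxL]
      intro B hB
      rwa [huniv (hL B hB), ← huniv (hP.1 A hA)]
    · have hcount : #L = if π ∈ L then 1 else 0 := by
        split_ifs with h
        · exact card_eq_one.2 ⟨π, eq_singleton_iff_unique_mem.2
            ⟨h, fun B hB => (huniv (hL B hB)).trans (huniv hπ).symm⟩⟩
        · refine card_eq_zero.2 (eq_empty_of_forall_notMem fun B hB => h ?_)
          rwa [huniv hπ, ← huniv (hL B hB)]
      have hempty : L.filter (fun A => Disjoint A π) = ∅ := by
        refine filter_eq_empty_iff.2 fun B hB hBπ => ?_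
        rw [huniv hπ, huniv (hL B hB)] at hBπ
        exact univ_nonempty.ne_empty (disjoint_self_iff_empty _ |>.1 hBπ)
      rw [hempty, hxL, hcount]
      simp
  · obtain ⟨m, hm⟩ := hdvd
    have hm2 : 2 ≤ m := by
      by_contra! h
      interval_cases m <;> omega
    have h2k : k * 2 ≤ Fintype.card α := hm ▸ Nat.mul_le_mul_left k hm2
    obtain ⟨A₀, -, hA₀⟩ := exists_subset_card_eq (s := (univ : Finset α)) (n := k)
      (by rw [card_univ]; omega)
    obtain ⟨B₀, hB₀A, hB₀⟩ := exists_subset_card_eq (s := A₀ᶜ) (n := k)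
      (by rw [card_compl]; omega)
    exact isCameronLieblerQ_iff_of_disjoint ⟨m, hm⟩ hk1 hA₀ hB₀
      (subset_compl_iff_disjoint_left.1 hB₀A) hL hx
end

section
/- Let Ω be a finite set with |Ω| = n, let k satisfy 1 ≤ k and 2k ≤ n, and let K be the Kneser (disjointness) matrix of k-subsets of Ω, viewed as a matrix over ℚ. Then the characteristic polynomial of K equals ∏_{j=0}^{k} (X − λ_j)^{m_j}, where λ_j = (−1)^j · C(n−k−j, k−j) and m_j = C(n, j) − C(n, j−1) (with C(n, −1) = 0); in particular, the eigenvalues of K are the numbers λ_j for j = 0, …, k, and λ_j has multiplicity m_j. -/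
namespace Kneser

variable {α : Type*}

/-- The functions supported on the sets with `j` elements. -/
def level (α : Type*) (j : ℕ) : Submodule ℚ (Finset α → ℚ) where
  carrier := {f | ∀ A, A.card ≠ j → f A = 0}
  add_mem' hf hg A hA := by simp [hf A hA, hg A hA]
  zero_mem' A _ := rfl
  smul_mem' c f hf A hA := by simp [hf A hA]

/-- Summation over all subsets. -/
def zeta : (Finset α → ℚ) →ₗ[ℚ] (Finset α → ℚ) where
  toFun f A := ∑ J ∈ A.powerset, f J
  map_add' f g := by ext A; simp [Finset.sum_add_distrib]
  map_smul' c f := by ext A; simp [Finset.mul_sum]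

lemma zeta_apply (f : Finset α → ℚ) (A : Finset α) : zeta f A = ∑ J ∈ A.powerset, f J := rfl

lemma zeta_of_card_eq {k : ℕ} {f : Finset α → ℚ} (hf : f ∈ level α k) {A : Finset α}
    (hA : A.card = k) : zeta f A = f A := by
  rw [zeta_apply]
  refine Finset.sum_eq_single A (fun J hJ hne => hf _ fun hJk => hne ?_) (by simp)
  exact Finset.eq_of_subset_of_card_le (Finset.mem_powerset.1 hJ) (by omega)

lemma finrank_level [Fintype α] (j : ℕ) :
    Module.finrank ℚ (level α j) = (Fintype.card α).choose j := by
  let e : level α j ≃ₗ[ℚ] ({A : Finset α // A.card = j} → ℚ) :=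
    { toFun := fun f A => f.1 A.1
      map_add' := fun _ _ => rfl
      map_smul' := fun _ _ => rfl
      invFun := fun g => ⟨fun A => if h : A.card = j then g ⟨A, h⟩ else 0,
        fun A hA => by simp [hA]⟩
      left_inv := fun f => by
        ext A
        by_cases hA : A.card = j
        · simp [hA]
        · simp [hA, f.2 A hA]
      right_inv := fun g => by
        ext A
        simp [A.2] }
  classical
  rw [e.finrank_eq, Module.finrank_fintype_fun_eq_card, Fintype.card_finset_len]

variable [DecidableEq α]

/-- The raising operator on functions on the Boolean lattice. -/
def up : (Finset α → ℚ) →ₗ[ℚ] (Finset α → ℚ) where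
  toFun f A := ∑ a ∈ A, f (A.erase a)
  map_add' f g := by ext A; simp [Finset.sum_add_distrib]
  map_smul' c f := by ext A; simp [Finset.mul_sum]

lemma up_apply (f : Finset α → ℚ) (A : Finset α) : up f A = ∑ a ∈ A, f (A.erase a) := rfl

lemma up_mem_level {j : ℕ} {f : Finset α → ℚ} (hf : f ∈ level α j) :
    up f ∈ level α (j + 1) := by
  intro A hA
  refine Finset.sum_eq_zero fun a ha => hf _ ?_
  have := Finset.card_erase_add_one ha
  omega

variable [Fintype α]
/-- The lowering operator on functions on the Boolean lattice. -/
def down : (Finset α → ℚ) →ₗ[ℚ] (Finset α → ℚ) where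
  toFun f A := ∑ a ∈ Aᶜ, f (insert a A)
  map_add' f g := by ext A; simp [Finset.sum_add_distrib]
  map_smul' c f := by ext A; simp [Finset.mul_sum]

lemma down_apply (f : Finset α → ℚ) (A : Finset α) :
    down f A = ∑ a ∈ Aᶜ, f (insert a A) := rfl

lemma down_mem_level {j : ℕ} {f : Finset α → ℚ} (hf : f ∈ level α (j + 1)) :
    down f ∈ level α j := by
  intro A hA
  refine Finset.sum_eq_zero fun a ha => hf _ ?_
  rw [Finset.card_insert_of_notMem (Finset.mem_compl.1 ha)]
  omega

lemma down_eq_zero {f : Finset α → ℚ} (hf : f ∈ level α 0) : down f = 0 := by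
  ext A
  refine Finset.sum_eq_zero fun a ha => hf _ ?_
  rw [Finset.card_insert_of_notMem (Finset.mem_compl.1 ha)]
  omega

/-- Double counting of the covering pairs of the Boolean lattice. -/
lemma sum_sum_mem_eq_sum_sum_compl (F : Finset α → α → ℚ) :
    ∑ J, ∑ a ∈ J, F J a = ∑ C : Finset α, ∑ a ∈ Cᶜ, F (insert a C) a := by
  rw [Finset.sum_sigma', Finset.sum_sigma']
  refine Finset.sum_bij' (fun x _ => ⟨x.1.erase x.2, x.2⟩) (fun x _ => ⟨insert x.2 x.1, x.2⟩)
    ?_ ?_ ?_ ?_ ?_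
  · simp
  · simp
  · rintro ⟨J, a⟩ h
    simp at h
    simp [h]
  · rintro ⟨J, a⟩ h
    simp at h
    simp [h]
  · rintro ⟨J, a⟩ h
    simp at h
    simp [h]

lemma up_dotProduct (f g : Finset α → ℚ) : up f ⬝ᵥ g = f ⬝ᵥ down g := by
  simp only [dotProduct, up_apply, down_apply, Finset.sum_mul, Finset.mul_sum]
  rw [sum_sum_mem_eq_sum_sum_compl]
  refine Finset.sum_congr rfl fun C _ => Finset.sum_congr rfl fun a ha => ?_
  rw [Finset.erase_insert (Finset.mem_compl.1 ha)]

lemma down_up_apply (f : Finset α → ℚ) (A : Finset α) :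
    down (up f) A = up (down f) A + ((Fintype.card α : ℚ) - 2 * A.card) * f A := by
  have h1 : down (up f) A =
      ∑ a ∈ Aᶜ, (f A + ∑ b ∈ A, f (insert a (A.erase b))) := by
    refine Finset.sum_congr rfl fun a ha => ?_
    rw [Finset.mem_compl] at ha
    rw [up_apply, Finset.sum_insert ha, Finset.erase_insert ha]
    congr 1
    refine Finset.sum_congr rfl fun b hb => ?_
    rw [Finset.erase_insert_of_ne]
    rintro rfl
    exact ha hb
  have h2 : up (down f) A =
      ∑ b ∈ A, (f A + ∑ a ∈ Aᶜ, f (insert a (A.erase b))) := by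
    refine Finset.sum_congr rfl fun b hb => ?_
    rw [down_apply, Finset.compl_erase, Finset.sum_insert (by simpa using hb),
      Finset.insert_erase hb]
  rw [h1, h2, Finset.sum_add_distrib, Finset.sum_add_distrib, Finset.sum_comm]
  simp only [Finset.sum_const, Finset.card_compl, nsmul_eq_mul]
  rw [Nat.cast_sub (Finset.card_le_univ A)]
  ring

lemma eq_zero_of_down_up_eq_zero {i : ℕ} (hi : 2 * i < Fintype.card α) {f : Finset α → ℚ}
    (hf : f ∈ level α i) (h : down (up f) = 0) : f = 0 := by
  have h1 : down (up f) = up (down f) + ((Fintype.card α : ℚ) - 2 * i) • f := by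
    ext A
    rw [down_up_apply]
    by_cases hA : A.card = i
    · simp [hA]
    · simp [hf A hA]
  have h2 : down f ⬝ᵥ down f + ((Fintype.card α : ℚ) - 2 * i) * (f ⬝ᵥ f) = 0 := by
    rw [← up_dotProduct, ← smul_eq_mul, ← smul_dotProduct, ← add_dotProduct, ← h1, h,
      zero_dotProduct]
  have h3 : (0 : ℚ) < (Fintype.card α : ℚ) - 2 * i := by
    rw [sub_pos]
    exact_mod_cast hi
  have h4 : 0 ≤ down f ⬝ᵥ down f := Finset.sum_nonneg fun _ _ => mul_self_nonneg _
  have h5 : 0 ≤ f ⬝ᵥ f := Finset.sum_nonneg fun _ _ => mul_self_nonneg _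
  refine dotProduct_self_eq_zero.1 (le_antisymm ?_ h5)
  by_contra! h6
  have := mul_pos h3 h6
  linarith

lemma exists_down_up_eq {i : ℕ} (hi : 2 * i < Fintype.card α) {g : Finset α → ℚ}
    (hg : g ∈ level α i) : ∃ f ∈ level α i, down (up f) = g := by
  have hm : ∀ f ∈ level α i, (down ∘ₗ up) f ∈ level α i :=
    fun f hf => down_mem_level (up_mem_level hf)
  have hinj : Function.Injective ((down ∘ₗ up).restrict hm) := by
    rw [← LinearMap.ker_eq_bot, LinearMap.ker_eq_bot']
    intro f h
    exact Subtype.ext (eq_zero_of_down_up_eq_zero hi f.2 (congrArg Subtype.val h))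
  obtain ⟨f, hf⟩ := LinearMap.injective_iff_surjective.1 hinj ⟨g, hg⟩
  exact ⟨f, f.2, congrArg Subtype.val hf⟩

/-- The functions on the sets with `j` elements killed by the lowering operator. -/
def harmonic (α : Type*) [Fintype α] [DecidableEq α] (j : ℕ) : Submodule ℚ (Finset α → ℚ) :=
  level α j ⊓ LinearMap.ker down

lemma exists_eq_up_add_harmonic {i : ℕ} (hi : 2 * i < Fintype.card α) {g : Finset α → ℚ}
    (hg : g ∈ level α (i + 1)) :
    ∃ f ∈ level α i, ∃ h ∈ harmonic α (i + 1), g = up f + h := by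
  obtain ⟨f, hf, hfg⟩ := exists_down_up_eq hi (down_mem_level hg)
  refine ⟨f, hf, g - up f, ⟨sub_mem hg (up_mem_level hf), ?_⟩, by abel⟩
  exact LinearMap.mem_ker.2 (by rw [map_sub, hfg, sub_self])

lemma finrank_harmonic_succ {i : ℕ} (hi : 2 * i < Fintype.card α) :
    Module.finrank ℚ (harmonic α (i + 1)) + (Fintype.card α).choose i =
      (Fintype.card α).choose (i + 1) := by
  let φ : (level α i × harmonic α (i + 1)) →ₗ[ℚ] (Finset α → ℚ) :=
    (up ∘ₗ (level α i).subtype).coprod (harmonic α (i + 1)).subtype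
  have hinj : Function.Injective φ := by
    rw [← LinearMap.ker_eq_bot, LinearMap.ker_eq_bot']
    rintro ⟨f, h⟩ hfh
    have h1 : up f.1 + h.1 = 0 := hfh
    have h2 : down h.1 = 0 := h.2.2
    have h3 : f.1 = 0 := by
      refine eq_zero_of_down_up_eq_zero hi f.2 ?_
      simpa [h2] using congrArg down h1
    rw [h3, map_zero, zero_add] at h1
    exact Prod.ext (Subtype.ext h3) (Subtype.ext h1)
  have hrange : LinearMap.range φ = level α (i + 1) := by
    refine le_antisymm ?_ fun g hg => ?_
    · rintro _ ⟨⟨f, h⟩, rfl⟩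
      exact add_mem (up_mem_level f.2) h.2.1
    · obtain ⟨f, hf, h, hh, rfl⟩ := exists_eq_up_add_harmonic hi hg
      exact ⟨(⟨f, hf⟩, ⟨h, hh⟩), rfl⟩
  have := LinearMap.finrank_range_of_inj hinj
  rw [hrange, Module.finrank_prod, finrank_level, finrank_level] at this
  omega

lemma finrank_harmonic {j k : ℕ} (hjk : j ≤ k) (hk : 2 * k ≤ Fintype.card α) :
    Module.finrank ℚ (harmonic α j) = (Fintype.card α).choose j -
      if j = 0 then 0 else (Fintype.card α).choose (j - 1) := by
  cases j with
  | zero =>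
    have : harmonic α 0 = level α 0 :=
      inf_eq_left.2 fun f hf => LinearMap.mem_ker.2 (down_eq_zero hf)
    rw [this, finrank_level]
    simp
  | succ i =>
    have := finrank_harmonic_succ (α := α) (i := i) (by omega)
    simp only [Nat.add_eq_zero_iff, one_ne_zero, and_false, if_false, Nat.add_sub_cancel]
    omega

lemma zeta_apply_eq_sum_ite (f : Finset α → ℚ) (A : Finset α) :
    zeta f A = ∑ J, if J ⊆ A then f J else 0 := by
  rw [zeta_apply, ← Finset.sum_filter]
  congr 1
  ext J
  simp

lemma zeta_up {i : ℕ} {f : Finset α → ℚ} (hf : f ∈ level α i) (A : Finset α) :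
    zeta (up f) A = ((A.card : ℚ) - i) * zeta f A := by
  have h1 : zeta (up f) A =
      ∑ J, ∑ a ∈ J, if J ⊆ A then f (J.erase a) else 0 := by
    rw [zeta_apply_eq_sum_ite]
    refine Finset.sum_congr rfl fun J _ => ?_
    split_ifs <;> simp [up_apply]
  rw [h1, sum_sum_mem_eq_sum_sum_compl, zeta_apply_eq_sum_ite, Finset.mul_sum]
  refine Finset.sum_congr rfl fun C _ => ?_
  have h2 : ∀ a ∈ Cᶜ, (if insert a C ⊆ A then f ((insert a C).erase a) else 0) =
      if a ∈ A ∧ C ⊆ A then f C else 0 := by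
    intro a ha
    simp only [Finset.erase_insert (Finset.mem_compl.1 ha), Finset.insert_subset_iff]
  rw [Finset.sum_congr rfl h2]
  by_cases hCA : C ⊆ A
  · simp only [hCA, and_true, if_true]
    by_cases hC : C.card = i
    · rw [← Finset.sum_filter, Finset.sum_const, nsmul_eq_mul]
      have : Cᶜ.filter (· ∈ A) = A \ C := by ext; simp [and_comm]
      rw [this, Finset.card_sdiff_of_subset hCA, Nat.cast_sub (Finset.card_le_card hCA), hC]
    · simp [hf C hC]
  · simp [hCA]

lemma sum_superset_eq_zero {j : ℕ} {h : Finset α → ℚ} (hh : h ∈ harmonic α j)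
    {S : Finset α} (hS : S.card ≠ j) : (∑ J, if S ⊆ J then h J else 0) = 0 := by
  have h1 : (∑ C, if S ⊆ C then down h C else 0) = 0 := by
    rw [LinearMap.mem_ker.1 hh.2]
    simp
  have h2 : (∑ C, if S ⊆ C then down h C else 0) =
      ∑ C : Finset α, ∑ a ∈ Cᶜ, if S ⊆ (insert a C).erase a then h (insert a C) else 0 := by
    refine Finset.sum_congr rfl fun C _ => ?_
    have : ∀ a ∈ Cᶜ, (if S ⊆ (insert a C).erase a then h (insert a C) else 0) =
        if S ⊆ C then h (insert a C) else 0 := by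
      intro a ha
      rw [Finset.erase_insert (Finset.mem_compl.1 ha)]
    rw [Finset.sum_congr rfl this]
    split_ifs <;> simp [down_apply]
  rw [h2, ← sum_sum_mem_eq_sum_sum_compl
    fun J a => if S ⊆ J.erase a then h J else 0] at h1
  have h3 : (∑ J, ∑ a ∈ J, if S ⊆ J.erase a then h J else 0) =
      ((j : ℚ) - S.card) * ∑ J, if S ⊆ J then h J else 0 := by
    rw [Finset.mul_sum]
    refine Finset.sum_congr rfl fun J _ => ?_
    by_cases hSJ : S ⊆ J
    · by_cases hJ : J.card = j
      · simp only [Finset.subset_erase, hSJ, true_and, if_true]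
        rw [← Finset.sum_filter, Finset.sum_const, nsmul_eq_mul]
        have : J.filter (· ∉ S) = J \ S := by ext; simp
        rw [this, Finset.card_sdiff_of_subset hSJ, Nat.cast_sub (Finset.card_le_card hSJ), hJ]
      · simp [hh.1 J hJ]
    · simp [Finset.subset_erase, hSJ]
  rw [h3] at h1
  refine (mul_eq_zero.1 h1).resolve_left (sub_ne_zero.2 ?_)
  exact_mod_cast hS.symm

lemma sum_disjoint_harmonic {j : ℕ} {h : Finset α → ℚ} (hh : h ∈ harmonic α j)
    (A : Finset α) : (∑ J, if Disjoint A J then h J else 0) = (-1) ^ j * zeta h A := by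
  have h1 : ∀ J : Finset α, (if Disjoint A J then h J else 0) =
      ∑ S ∈ A.powerset, (-1 : ℚ) ^ S.card * if S ⊆ J then h J else 0 := by
    intro J
    have h2 : (∑ S ∈ (A ∩ J).powerset, (-1 : ℚ) ^ S.card) = if A ∩ J = ∅ then 1 else 0 := by
      exact_mod_cast congrArg (Int.cast : ℤ → ℚ)
        (Finset.sum_powerset_neg_one_pow_card (x := A ∩ J))
    have h3 : (A ∩ J).powerset = A.powerset.filter (· ⊆ J) := by
      ext S
      rw [Finset.mem_powerset, Finset.mem_filter, Finset.mem_powerset, Finset.subset_inter_iff]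
    simp only [mul_ite, mul_zero]
    rw [← Finset.sum_filter, ← h3, ← Finset.sum_mul, h2]
    simp [Finset.disjoint_iff_inter_eq_empty]
  rw [Finset.sum_congr rfl fun J _ => h1 J, Finset.sum_comm, zeta_apply, Finset.mul_sum]
  refine Finset.sum_congr rfl fun S _ => ?_
  rw [← Finset.mul_sum]
  by_cases hS : S.card = j
  · rw [hS, Finset.sum_eq_single S]
    · simp
    · intro J _ hJS
      split_ifs with hSJ
      · refine hh.1 J fun hJ => hJS ?_
        exact (Finset.eq_of_subset_of_card_le hSJ (by omega)).symm
      · rfl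
    · simp
  · rw [sum_superset_eq_zero hh hS, hh.1 S hS, mul_zero, mul_zero]

lemma card_filter_subset_disjoint {A J : Finset α} (hAJ : Disjoint A J) {k : ℕ}
    (hJ : J.card ≤ k) :
    (Finset.univ.filter fun B : Finset α => B.card = k ∧ J ⊆ B ∧ Disjoint A B).card =
      (Fintype.card α - A.card - J.card).choose (k - J.card) := by
  have h1 : (Aᶜ \ J).card = Fintype.card α - A.card - J.card := by
    rw [Finset.card_sdiff_of_subset, Finset.card_compl]
    rw [Finset.subset_compl_iff_disjoint_left]
    exact hAJ
  rw [← h1, ← Finset.card_powersetCard]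
  refine Finset.card_bij' (fun B _ => B \ J) (fun B _ => B ∪ J) ?_ ?_ ?_ ?_
  · intro B hB
    simp only [Finset.mem_filter, Finset.mem_univ, true_and] at hB
    rw [Finset.mem_powersetCard, Finset.card_sdiff_of_subset hB.2.1, hB.1]
    refine ⟨Finset.sdiff_subset_sdiff ?_ le_rfl, rfl⟩
    rw [Finset.subset_compl_iff_disjoint_left]
    exact hB.2.2
  · intro B hB
    rw [Finset.mem_powersetCard, Finset.subset_sdiff,
      Finset.subset_compl_iff_disjoint_left] at hB
    simp only [Finset.mem_filter, Finset.mem_univ, true_and]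
    refine ⟨?_, Finset.subset_union_right, Finset.disjoint_union_right.2 ⟨hB.1.1, hAJ⟩⟩
    rw [Finset.card_union_of_disjoint hB.1.2, hB.2]
    omega
  · intro B hB
    simp only [Finset.mem_filter, Finset.mem_univ, true_and] at hB
    exact Finset.sdiff_union_of_subset hB.2.1
  · intro B hB
    rw [Finset.mem_powersetCard, Finset.subset_sdiff] at hB
    exact Finset.union_sdiff_cancel_right hB.1.2

lemma sum_disjoint_zeta_harmonic {j k : ℕ} (hjk : j ≤ k) {h : Finset α → ℚ}
    (hh : h ∈ harmonic α j) {A : Finset α} (hA : A.card = k) :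
    (∑ B : {B : Finset α // B.card = k}, if Disjoint A B.1 then zeta h B.1 else 0) =
      (-1) ^ j * ((Fintype.card α - k - j).choose (k - j) : ℚ) * zeta h A := by
  have h1 : (∑ B : {B : Finset α // B.card = k}, if Disjoint A B.1 then zeta h B.1 else 0) =
      ∑ B : Finset α, ∑ J, if B.card = k ∧ J ⊆ B ∧ Disjoint A B then h J else 0 := by
    rw [← Finset.sum_subtype (Finset.univ.filter fun B : Finset α => B.card = k) (by simp)
      fun B => if Disjoint A B then zeta h B else 0, Finset.sum_filter]
    refine Finset.sum_congr rfl fun B _ => ?_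
    by_cases hB : B.card = k <;> by_cases hAB : Disjoint A B <;>
      simp [hB, hAB, zeta_apply_eq_sum_ite]
  rw [h1, Finset.sum_comm, mul_comm ((-1 : ℚ) ^ j), mul_assoc, ← sum_disjoint_harmonic hh,
    Finset.mul_sum]
  refine Finset.sum_congr rfl fun J _ => ?_
  by_cases hAJ : Disjoint A J
  · by_cases hJ : J.card = j
    · rw [← Finset.sum_filter, Finset.sum_const,
        card_filter_subset_disjoint hAJ (hJ.trans_le hjk), hA, hJ, if_pos hAJ, nsmul_eq_mul]
    · simp [hh.1 J hJ]
  · rw [if_neg hAJ, mul_zero]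
    refine Finset.sum_eq_zero fun B _ => if_neg ?_
    rintro ⟨-, hJB, hAB⟩
    exact hAJ (hAB.mono_right hJB)

/-- The sum of the zeta transforms of harmonic functions, restricted to the sets with
`k` elements. -/
def harmonicSum (α : Type*) [Fintype α] [DecidableEq α] (k : ℕ) :
    ((j : Fin (k + 1)) → harmonic α j) →ₗ[ℚ] ({A : Finset α // A.card = k} → ℚ) :=
  LinearMap.lsum ℚ _ ℚ fun j =>
    LinearMap.funLeft ℚ ℚ Subtype.val ∘ₗ zeta ∘ₗ (harmonic α j).subtype

lemma harmonicSum_single (k : ℕ) (j : Fin (k + 1)) (h : harmonic α j)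
    (A : {A : Finset α // A.card = k}) :
    harmonicSum α k (Pi.single j h) A = zeta h.1 A.1 := by
  rw [harmonicSum, LinearMap.lsum_piSingle]
  rfl

lemma zeta_mem_range_harmonicSum {k : ℕ} (hk : 2 * k ≤ Fintype.card α) {j : ℕ} (hjk : j ≤ k)
    {f : Finset α → ℚ} (hf : f ∈ level α j) :
    (fun A : {A : Finset α // A.card = k} => zeta f A.1) ∈
      LinearMap.range (harmonicSum α k) := by
  induction j generalizing f with
  | zero =>
    exact ⟨Pi.single 0 ⟨f, hf, LinearMap.mem_ker.2 (down_eq_zero hf)⟩,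
      funext fun A => harmonicSum_single k 0 _ A⟩
  | succ i ih =>
    obtain ⟨g, hg, h, hh, rfl⟩ := exists_eq_up_add_harmonic (by omega) hf
    have h1 : (fun A : {A : Finset α // A.card = k} => zeta (up g + h) A.1) =
        ((k : ℚ) - i) • (fun A : {A : Finset α // A.card = k} => zeta g A.1) +
          harmonicSum α k (Pi.single ⟨i + 1, by omega⟩ ⟨h, hh⟩) := by
      ext A
      rw [map_add, Pi.add_apply, Pi.add_apply, harmonicSum_single, zeta_up hg, A.2]
      rfl
    rw [h1]
    exact add_mem (Submodule.smul_mem _ _ (ih (by omega) hg)) ⟨_, rfl⟩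

lemma harmonicSum_surjective {k : ℕ} (hk : 2 * k ≤ Fintype.card α) :
    Function.Surjective (harmonicSum α k) := by
  intro g
  let f : Finset α → ℚ := fun A => if h : A.card = k then g ⟨A, h⟩ else 0
  have hf : f ∈ level α k := fun A hA => dif_neg hA
  have h1 : (fun A : {A : Finset α // A.card = k} => zeta f A.1) = g := by
    ext A
    rw [zeta_of_card_eq hf A.2]
    exact dif_pos A.2
  rw [← h1]
  exact zeta_mem_range_harmonicSum hk le_rfl hf

lemma sum_finrank_harmonic {k m : ℕ} (hk : 2 * k ≤ Fintype.card α) (hm : m ≤ k) :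
    ∑ j ∈ Finset.range (m + 1), Module.finrank ℚ (harmonic α j) =
      (Fintype.card α).choose m := by
  induction m with
  | zero => simp [finrank_harmonic (Nat.zero_le k) hk]
  | succ i ih =>
    rw [Finset.sum_range_succ, ih (by omega), add_comm, finrank_harmonic_succ (by omega)]

/-- The decomposition of the functions on the sets with `k` elements into harmonic parts. -/
noncomputable def harmonicEquiv {k : ℕ} (hk : 2 * k ≤ Fintype.card α) :
    ((j : Fin (k + 1)) → harmonic α j) ≃ₗ[ℚ] ({A : Finset α // A.card = k} → ℚ) :=
  LinearEquiv.ofBijective (harmonicSum α k) <| by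
    refine ⟨?_, harmonicSum_surjective hk⟩
    refine (LinearMap.injective_iff_surjective_of_finrank_eq_finrank ?_).2
      (harmonicSum_surjective hk)
    rw [Module.finrank_pi_fintype, Module.finrank_fintype_fun_eq_card, Fintype.card_finset_len,
      Fin.sum_univ_eq_sum_range fun j => Module.finrank ℚ (harmonic α j),
      sum_finrank_harmonic hk le_rfl]

end Kneser

theorem stmt_10 {α : Type*} [Fintype α] [DecidableEq α] {n k : ℕ}
    (hn : Fintype.card α = n) (hk1 : 1 ≤ k) (h2k : 2 * k ≤ n)
    (K : Matrix {A : Finset α // A.card = k} {A : Finset α // A.card = k} ℚ)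
    (hK : ∀ A B, K A B = if Disjoint A.1 B.1 then 1 else 0) :
    K.charpoly = ∏ j ∈ Finset.range (k + 1),
      (Polynomial.X - Polynomial.C ((-1 : ℚ) ^ j * ((n - k - j).choose (k - j) : ℚ))) ^
        (n.choose j - if j = 0 then 0 else n.choose (j - 1)) := by
  subst hn
  let b := (Pi.basis fun j : Fin (k + 1) =>
    Module.finBasis ℚ (Kneser.harmonic α j)).map (Kneser.harmonicEquiv h2k)
  let d : (Σ j : Fin (k + 1), Fin (Module.finrank ℚ (Kneser.harmonic α j))) → ℚ :=
    fun x => (-1 : ℚ) ^ (x.1 : ℕ) * ((Fintype.card α - k - x.1).choose (k - x.1) : ℚ)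
  have hb : ∀ x, Matrix.toLin' K (b x) = d x • b x := by
    rintro ⟨j, i⟩
    have h1 : ∀ A, b ⟨j, i⟩ A = Kneser.zeta (Module.finBasis ℚ (Kneser.harmonic α j) i).1 A.1 := by
      intro A
      rw [Module.Basis.map_apply, Pi.basis_apply]
      exact Kneser.harmonicSum_single k j _ A
    ext A
    rw [Matrix.toLin'_apply, Pi.smul_apply, h1, smul_eq_mul,
      ← Kneser.sum_disjoint_zeta_harmonic (Nat.lt_succ_iff.1 j.2) (Subtype.property _) A.2]
    refine Finset.sum_congr rfl fun B _ => ?_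
    change K A B * _ = _
    rw [hK, h1, ite_mul, one_mul, zero_mul]
  have hd : LinearMap.toMatrix b b (Matrix.toLin' K) = Matrix.diagonal d := by
    ext x y
    rw [LinearMap.toMatrix_apply, hb, map_smul, Module.Basis.repr_self, Finsupp.smul_single,
      Matrix.diagonal_apply, Finsupp.single_apply, smul_eq_mul, mul_one]
    by_cases hxy : x = y
    · simp [hxy]
    · simp [hxy, Ne.symm hxy]
  rw [← Matrix.charpoly_toLin', ← LinearMap.charpoly_toMatrix _ b, hd, Matrix.charpoly_diagonal,
    Fintype.prod_sigma, ← Fin.prod_univ_eq_prod_range]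
  refine Finset.prod_congr rfl fun j _ => ?_
  rw [← Kneser.finrank_harmonic (Nat.lt_succ_iff.1 j.2) h2k]
  simp [d]
end

section
/- Let Ω be a finite set with |Ω| = n, let k be a divisor of n with k ≥ 2 and n ≥ 3k, and let L be a nontrivial Cameron-Liebler class of k-sets with parameter x in Ω with x < n/k − 1. Then x = 1 and L is the family of all k-subsets of Ω containing some fixed element p ∈ Ω. -/
/-- Every finite set of size `m * k` splits into `m` blocks of size `k`. -/
theorem exists_uniform_blocks {α : Type*} [DecidableEq α] {k : ℕ} (hk : 0 < k) (m : ℕ) :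
    ∀ s : Finset α, s.card = m * k → ∃ P : Finset (Finset α), P.card = m ∧
      (∀ A ∈ P, A.card = k ∧ A ⊆ s) ∧ ∀ a ∈ s, ∃! A, A ∈ P ∧ a ∈ A := by
  induction m with
  | zero =>
    intro s hs
    refine ⟨∅, rfl, by simp, ?_⟩
    have : s = ∅ := by simpa using hs
    simp [this]
  | succ m ih =>
    intro s hs
    obtain ⟨B, hBs, hB⟩ := Finset.exists_subset_card_eq
      (show k ≤ s.card by rw [hs]; exact Nat.le_mul_of_pos_left k (Nat.succ_pos m))
    obtain ⟨P, hPm, hP, hu⟩ := ih (s \ B) (by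
      rw [Finset.card_sdiff_of_subset hBs, hs, hB, Nat.succ_mul, Nat.add_sub_cancel])
    have hBP : ∀ A ∈ P, ∀ a ∈ B, a ∉ A := fun A hA a ha haA =>
      (Finset.mem_sdiff.1 ((hP A hA).2 haA)).2 ha
    have hBne : B.Nonempty := Finset.card_pos.1 (by omega)
    obtain ⟨b, hb⟩ := hBne
    refine ⟨insert B P, ?_, ?_, ?_⟩
    · rw [Finset.card_insert_of_notMem (fun h => hBP B h b hb hb), hPm]
    · intro A hA
      rcases Finset.mem_insert.1 hA with rfl | hA
      · exact ⟨hB, hBs⟩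
      · exact ⟨(hP A hA).1, (hP A hA).2.trans Finset.sdiff_subset⟩
    · intro a ha
      by_cases haB : a ∈ B
      · refine ⟨B, ⟨Finset.mem_insert_self _ _, haB⟩, ?_⟩
        rintro A ⟨hA, haA⟩
        rcases Finset.mem_insert.1 hA with rfl | hA
        · rfl
        · exact absurd haA (hBP A hA a haB)
      · obtain ⟨A, ⟨hA, haA⟩, huA⟩ := hu a (Finset.mem_sdiff.2 ⟨ha, haB⟩)
        refine ⟨A, ⟨Finset.mem_insert_of_mem hA, haA⟩, ?_⟩
        rintro C ⟨hC, haC⟩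
        rcases Finset.mem_insert.1 hC with rfl | hC
        · exact absurd haC haB
        · exact huA C ⟨hC, haC⟩

/-- Two disjoint `k`-sets extend to a uniform partition by a family depending only on
their union. -/
theorem exists_uniformPartition_extension {α : Type*} [Fintype α] [DecidableEq α] {k : ℕ}
    (hk : 0 < k) (hdvd : k ∣ Fintype.card α) (U : Finset α) (hU : U.card = 2 * k) :
    ∃ P : Finset (Finset α), ∀ A B : Finset α, A.card = k → B.card = k → Disjoint A B →
      A ∪ B = U → A ∉ insert B P ∧ B ∉ P ∧ IsUniformPartition k (insert A (insert B P)) := by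
  obtain ⟨m, hm⟩ := hdvd
  obtain ⟨P, -, hP, hu⟩ := exists_uniform_blocks hk (m - 2) (Finset.univ \ U) (by
    rw [Finset.card_sdiff_of_subset (Finset.subset_univ _), Finset.card_univ, hm, hU,
      Nat.sub_mul, mul_comm k m])
  refine ⟨P, fun A B hA hB hAB hABU => ?_⟩
  have hnot : ∀ C ∈ P, ∀ a ∈ C, a ∉ A ∧ a ∉ B := by
    intro C hC a ha
    have := (Finset.mem_sdiff.1 ((hP C hC).2 ha)).2
    rw [← hABU, Finset.mem_union] at this
    tauto
  obtain ⟨a₀, ha₀⟩ : A.Nonempty := Finset.card_pos.1 (by omega)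
  obtain ⟨b₀, hb₀⟩ : B.Nonempty := Finset.card_pos.1 (by omega)
  have hdisj := Finset.disjoint_left.1 hAB
  refine ⟨?_, fun h => (hnot B h b₀ hb₀).2 hb₀, ?_, ?_⟩
  · intro h
    rcases Finset.mem_insert.1 h with rfl | h
    · exact hdisj ha₀ ha₀
    · exact (hnot A h a₀ ha₀).1 ha₀
  · intro C hC
    simp only [Finset.mem_insert] at hC
    rcases hC with rfl | rfl | hC
    · exact hA
    · exact hB
    · exact (hP C hC).1
  · intro a
    by_cases haU : a ∈ U
    · rw [← hABU, Finset.mem_union] at haU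
      rcases haU with ha | ha
      · refine ⟨A, ⟨by simp, ha⟩, ?_⟩
        rintro C ⟨hC, haC⟩
        simp only [Finset.mem_insert] at hC
        rcases hC with rfl | rfl | hC
        · rfl
        · exact absurd haC (hdisj ha)
        · exact absurd ha (hnot C hC a haC).1
      · refine ⟨B, ⟨by simp, ha⟩, ?_⟩
        rintro C ⟨hC, haC⟩
        simp only [Finset.mem_insert] at hC
        rcases hC with rfl | rfl | hC
        · exact absurd ha (hdisj haC)
        · rfl
        · exact absurd ha (hnot C hC a haC).2
    · obtain ⟨C, ⟨hC, haC⟩, hCu⟩ := hu a (by simp [haU])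
      refine ⟨C, ⟨by simp [hC], haC⟩, ?_⟩
      rintro D ⟨hD, haD⟩
      rw [← hABU, Finset.mem_union] at haU
      simp only [Finset.mem_insert] at hD
      rcases hD with rfl | rfl | hD
      · exact absurd (Or.inl haD) haU
      · exact absurd (Or.inr haD) haU
      · exact hCu D ⟨hD, haD⟩

/-- A function on finite sets that is invariant under single exchanges avoiding `F` is constant
on the sets of a given size disjoint from `F`. -/
theorem eq_of_exchange_invariant {α β : Type*} [DecidableEq α] {k : ℕ} (F : Finset α)
    (g : Finset α → β)
    (hg : ∀ S : Finset α, S.card = k → Disjoint S F → ∀ u ∈ S, ∀ v, v ∉ S → v ∉ F →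
      g S = g (insert v (S.erase u)))
    {S T : Finset α} (hS : S.card = k) (hT : T.card = k) (hSF : Disjoint S F)
    (hTF : Disjoint T F) : g S = g T := by
  induction h : (S \ T).card generalizing S with
  | zero =>
    have hST : S ⊆ T := by simpa using h
    rw [Finset.eq_of_subset_of_card_le hST (by omega)]
  | succ m ih =>
    obtain ⟨u, hu⟩ : (S \ T).Nonempty := Finset.card_pos.1 (by omega)
    have hcard : (T \ S).card = (S \ T).card := Finset.card_sdiff_comm (by omega)
    obtain ⟨v, hv⟩ : (T \ S).Nonempty := Finset.card_pos.1 (by omega)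
    rw [Finset.mem_sdiff] at hu hv
    have hvF : v ∉ F := Finset.disjoint_left.1 hTF hv.1
    rw [hg S hS hSF u hu.1 v hv.2 hvF]
    refine ih ?_ ?_ ?_
    · rw [Finset.card_insert_of_notMem (by simp [hv.2]), Finset.card_erase_of_mem hu.1]
      have := Finset.card_pos.2 ⟨u, hu.1⟩
      omega
    · rw [Finset.disjoint_insert_left]
      exact ⟨hvF, hSF.mono_left (Finset.erase_subset _ _)⟩
    · rw [Finset.insert_sdiff_of_mem _ hv.1, Finset.erase_sdiff_comm, Finset.card_erase_of_mem
        (by simp [hu]), h, Nat.add_sub_cancel]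

/-- There is a set of any prescribed size avoiding a small enough set. -/
theorem exists_card_eq_disjoint {α : Type*} [Fintype α] [DecidableEq α] (F : Finset α) {m : ℕ}
    (h : m + F.card ≤ Fintype.card α) : ∃ S : Finset α, S.card = m ∧ Disjoint S F := by
  obtain ⟨S, hS, hm⟩ := Finset.exists_subset_card_eq
    (show m ≤ Fᶜ.card by rw [Finset.card_compl]; omega)
  exact ⟨S, hm, Finset.disjoint_left.2 fun a ha => Finset.mem_compl.1 (hS ha)⟩

/-- The integer indicator of membership in a family. -/
def familyIndicator {α : Type*} [DecidableEq α] (L : Finset (Finset α)) (A : Finset α) : ℤ :=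
  if A ∈ L then 1 else 0

theorem card_inter_eq_sum_familyIndicator {α : Type*} [DecidableEq α]
    (L P : Finset (Finset α)) : ((L ∩ P).card : ℤ) = ∑ A ∈ P, familyIndicator L A := by
  simp only [familyIndicator, Finset.sum_boole]
  rw [Finset.inter_comm, Finset.filter_mem_eq_inter]

theorem familyIndicator_swap_of_disjoint {α : Type*} [Fintype α] [DecidableEq α] {k x : ℕ}
    (hk : 0 < k) (hdvd : k ∣ Fintype.card α) {L : Finset (Finset α)}
    (hCL : IsCameronLiebler k x L) {S T : Finset α} {a b : α} (hab : a ≠ b)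
    (hS : S.card + 1 = k) (hT : T.card + 1 = k) (hST : Disjoint S T)
    (haS : a ∉ S) (hbS : b ∉ S) (haT : a ∉ T) (hbT : b ∉ T) :
    familyIndicator L (insert a S) - familyIndicator L (insert b S) =
      familyIndicator L (insert a T) - familyIndicator L (insert b T) := by
  have hcard : ∀ {R : Finset α} {c : α}, c ∉ R → R.card + 1 = k → (insert c R).card = k := by
    intro R c hc hR
    rw [Finset.card_insert_of_notMem hc, hR]
  have hd : ∀ {c d : α}, c ≠ d → c ∉ T → d ∉ S → Disjoint (insert c S) (insert d T) := by
    intro c d hcd hc hd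
    simp [hc, hd, hST, hcd.symm]
  obtain ⟨P, hP⟩ := exists_uniformPartition_extension hk hdvd (insert a S ∪ insert b T) (by
    rw [Finset.card_union_of_disjoint (hd hab haT hbS), hcard haS hS, hcard hbT hT, two_mul])
  have key : ∀ A B : Finset α, A.card = k → B.card = k → Disjoint A B →
      A ∪ B = insert a S ∪ insert b T →
      familyIndicator L A + (familyIndicator L B + ∑ C ∈ P, familyIndicator L C) = x := by
    intro A B hA hB hAB hU
    obtain ⟨h1, h2, h3⟩ := hP A B hA hB hAB hU
    rw [← hCL.2 _ h3, card_inter_eq_sum_familyIndicator, Finset.sum_insert h1,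
      Finset.sum_insert h2]
  have e1 := key _ _ (hcard haS hS) (hcard hbT hT) (hd hab haT hbS) rfl
  have e2 := key _ _ (hcard hbS hS) (hcard haT hT) (hd hab.symm hbT haS) (by
    ext c; simp only [Finset.mem_union, Finset.mem_insert]; tauto)
  linarith

theorem familyIndicator_swap {α : Type*} [Fintype α] [DecidableEq α] {k x : ℕ}
    (hk : 2 ≤ k) (hdvd : k ∣ Fintype.card α) (h3k : 3 * k ≤ Fintype.card α)
    {L : Finset (Finset α)} (hCL : IsCameronLiebler k x L) {S T : Finset α} {a b : α}
    (hS : S.card = k - 1) (hT : T.card = k - 1)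
    (haS : a ∉ S) (hbS : b ∉ S) (haT : a ∉ T) (hbT : b ∉ T) :
    familyIndicator L (insert a S) - familyIndicator L (insert b S) =
      familyIndicator L (insert a T) - familyIndicator L (insert b T) := by
  rcases eq_or_ne a b with rfl | hab
  · simp
  refine eq_of_exchange_invariant {a, b}
    (fun S => familyIndicator L (insert a S) - familyIndicator L (insert b S)) ?_ hS hT
    (by simp [haS, hbS]) (by simp [haT, hbT])
  intro S hS hSF u hu v hv hvF
  simp only [Finset.disjoint_insert_right, Finset.disjoint_singleton_right] at hSF
  simp only [Finset.mem_insert, Finset.mem_singleton, not_or] at hvF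
  obtain ⟨R, hR, hRF⟩ := exists_card_eq_disjoint (insert a (insert b (insert v S)))
    (m := k - 1) (by
      have h1 := Finset.card_insert_le a (insert b (insert v S))
      have h2 := Finset.card_insert_le b (insert v S)
      have h3 := Finset.card_insert_le v S
      omega)
  simp only [Finset.disjoint_insert_right] at hRF
  obtain ⟨haR, hbR, hvR, hRS⟩ := hRF
  have hS' : (insert v (S.erase u)).card + 1 = k := by
    rw [Finset.card_insert_of_notMem (by simp [hv]), Finset.card_erase_of_mem hu]
    omega
  have hRS' : Disjoint (insert v (S.erase u)) R := by
    rw [Finset.disjoint_insert_left]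
    exact ⟨hvR, hRS.symm.mono_left (Finset.erase_subset _ _)⟩
  rw [familyIndicator_swap_of_disjoint (by omega) hdvd hCL hab (by omega) (by omega) hRS.symm
    hSF.1 hSF.2 haR hbR]
  exact (familyIndicator_swap_of_disjoint (by omega) hdvd hCL hab hS' (by omega) hRS'
    (by simp [hSF, Ne.symm hvF.1]) (by simp [hSF, Ne.symm hvF.2]) haR hbR).symm

/-- A Cameron-Liebler class has degree one: exchanging elements changes its indicator by a
difference of weights. -/
theorem exists_weight {α : Type*} [Fintype α] [DecidableEq α] {k x : ℕ}
    (hk : 2 ≤ k) (hdvd : k ∣ Fintype.card α) (h3k : 3 * k ≤ Fintype.card α)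
    {L : Finset (Finset α)} (hCL : IsCameronLiebler k x L) :
    ∃ w : α → ℤ, ∀ (S : Finset α) (a b : α), S.card = k - 1 → a ∉ S → b ∉ S →
      familyIndicator L (insert a S) - familyIndicator L (insert b S) = w a - w b := by
  obtain ⟨p⟩ : Nonempty α := Fintype.card_pos_iff.1 (by omega)
  have hex : ∀ i : α, ∃ S : Finset α, S.card = k - 1 ∧ Disjoint S {i, p} := fun i =>
    exists_card_eq_disjoint _ (by
      have := Finset.card_le_two (a := i) (b := p)
      omega)
  choose s hs hsd using hex
  simp only [Finset.disjoint_insert_right, Finset.disjoint_singleton_right] at hsd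
  refine ⟨fun i => familyIndicator L (insert i (s i)) - familyIndicator L (insert p (s i)), ?_⟩
  intro S a b hS ha hb
  obtain ⟨R, hR, hRF⟩ := exists_card_eq_disjoint {a, b, p} (m := k - 1) (by
    have := Finset.card_le_three (a := a) (b := b) (c := p)
    omega)
  simp only [Finset.disjoint_insert_right, Finset.disjoint_singleton_right] at hRF
  obtain ⟨haR, hbR, hpR⟩ := hRF
  have h1 := familyIndicator_swap hk hdvd h3k hCL (hs a) hR (hsd a).1 (hsd a).2 haR hpR
  have h2 := familyIndicator_swap hk hdvd h3k hCL (hs b) hR (hsd b).1 (hsd b).2 hbR hpR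
  have h3 := familyIndicator_swap hk hdvd h3k hCL hS hR ha hb haR hbR
  simp only
  linarith

theorem familyIndicator_eq_zero_or_one {α : Type*} [DecidableEq α] (L : Finset (Finset α))
    (A : Finset α) :
    (A ∉ L ∧ familyIndicator L A = 0) ∨ (A ∈ L ∧ familyIndicator L A = 1) := by
  unfold familyIndicator
  by_cases h : A ∈ L <;> simp [h]

theorem stmt_11 {α : Type*} [Fintype α] [DecidableEq α] {n k x : ℕ}
    (hn : Fintype.card α = n) (hdvd : k ∣ n) (hk2 : 2 ≤ k) (h3k : 3 * k ≤ n)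
    (L : Finset (Finset α)) (hCL : IsCameronLiebler k x L)
    (hne : L ≠ ∅) (hnall : L ≠ Finset.powersetCard k Finset.univ)
    (hx : x < n / k - 1) :
    x = 1 ∧ ∃ p : α, L = (Finset.powersetCard k Finset.univ).filter (fun A => p ∈ A) := by
  subst hn
  obtain ⟨w, hw⟩ := exists_weight hk2 hdvd h3k hCL
  have h01 := familyIndicator_eq_zero_or_one L
  have hexch : ∀ (A : Finset α) (u v : α), A.card = k → u ∈ A → v ∉ A →
      familyIndicator L A - familyIndicator L (insert v (A.erase u)) = w u - w v := by
    intro A u v hA hu hv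
    have := hw (A.erase u) u v (by rw [Finset.card_erase_of_mem hu, hA]) (by simp) (by simp [hv])
    rwa [Finset.insert_erase hu] at this
  obtain ⟨P, hPcard, hPk, hPu⟩ := exists_uniform_blocks (k := k) (by omega)
    (Fintype.card α / k) (Finset.univ : Finset α) (by
      rw [Finset.card_univ, Nat.div_mul_cancel hdvd])
  have hPx : (L ∩ P).card = x :=
    hCL.2 P ⟨fun A hA => (hPk A hA).1, fun a => hPu a (Finset.mem_univ a)⟩
  have hstar : ∀ p : α, (P.filter (fun A => p ∈ A)).card = 1 := by
    intro p
    obtain ⟨A, hA, hAu⟩ := hPu p (Finset.mem_univ p)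
    rw [Finset.card_eq_one]
    refine ⟨A, ?_⟩
    ext C
    simp only [Finset.mem_filter, Finset.mem_singleton]
    exact ⟨hAu C, fun h => h ▸ hA⟩
  have hbound : ∀ u v : α, w u - w v ≤ 1 := by
    intro u v
    obtain ⟨R, hR, hRF⟩ := exists_card_eq_disjoint {u, v} (m := k - 1) (by
      have := Finset.card_le_two (a := u) (b := v)
      omega)
    simp only [Finset.disjoint_insert_right, Finset.disjoint_singleton_right] at hRF
    rw [← hw R u v hR hRF.1 hRF.2]
    rcases h01 (insert u R) with h | h <;> rcases h01 (insert v R) with h' | h' <;> omega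
  have hnonconst : ∃ a b : α, w a - w b = 1 := by
    by_contra! hcon
    have hconst : ∀ u v, w u = w v := by
      intro u v
      have h1 := hbound u v
      have h2 := hbound v u
      have h3 := hcon u v
      have h4 := hcon v u
      omega
    obtain ⟨A, hA⟩ := Finset.nonempty_iff_ne_empty.2 hne
    refine hnall (Finset.Subset.antisymm (fun B hB => by simp [hCL.1 B hB]) fun B hB => ?_)
    have heq : familyIndicator L A = familyIndicator L B :=
      eq_of_exchange_invariant ∅ (familyIndicator L)
        (fun S hS _ u hu v hv _ => by
          have := hexch S u v hS hu hv
          have := hconst u v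
          omega) (hCL.1 A hA) (by simpa using hB) (by simp) (by simp)
    rcases h01 A with h | h <;> rcases h01 B with h' | h'
    · exact absurd hA h.1
    · exact h'.1
    · omega
    · exact h'.1
  obtain ⟨a, b, hab⟩ := hnonconst
  have hne' : a ≠ b := by
    rintro rfl
    omega
  have hdich : ∀ c, w c = w a ∨ w c = w b := by
    intro c
    have := hbound a c
    have := hbound c b
    omega
  have hcard_lt : ∀ A : Finset α, A.card = k → (∃ v, v ∉ A) ∧ ∃ u, u ∈ A := by
    intro A hA
    constructor
    · by_contra! h
      have : A.card = Fintype.card α := by rw [Finset.eq_univ_of_forall h, Finset.card_univ]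
      omega
    · exact Finset.card_pos.1 (by omega)
  by_cases hP1 : ∀ c, c ≠ a → w c = w b
  · have hL : L = (Finset.powersetCard k Finset.univ).filter (fun A => a ∈ A) := by
      ext A
      simp only [Finset.mem_filter, Finset.mem_powersetCard_univ]
      constructor
      · intro hA
        have hAk := hCL.1 A hA
        refine ⟨hAk, ?_⟩
        by_contra haA
        obtain ⟨-, u, hu⟩ := hcard_lt A hAk
        have h1 := hexch A u a hAk hu haA
        have h2 := hP1 u (fun h => haA (h ▸ hu))
        rcases h01 A with h | h
        · exact h.1 hA
        · rcases h01 (insert a (A.erase u)) with h' | h' <;> omega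
      · rintro ⟨hAk, haA⟩
        obtain ⟨⟨v, hv⟩, -⟩ := hcard_lt A hAk
        have h1 := hexch A a v hAk haA hv
        have h2 := hP1 v (fun h => hv (h ▸ haA))
        rcases h01 A with h | h
        · rcases h01 (insert v (A.erase a)) with h' | h' <;> omega
        · exact h.1
    refine ⟨?_, a, hL⟩
    rw [← hPx, ← hstar a]
    congr 1
    ext A
    rw [hL]
    simp only [Finset.mem_filter, Finset.mem_powersetCard_univ, Finset.mem_inter]
    exact ⟨fun h => ⟨h.2, h.1.2⟩, fun h => ⟨⟨(hPk A h.1).1, h.2⟩, h.1⟩⟩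
  exfalso
  push Not at hP1
  obtain ⟨c, hca, hcw⟩ := hP1
  have hcw : w c = w a := (hdich c).resolve_right hcw
  by_cases hQ1 : ∀ e, e ≠ b → w e = w a
  · have hL : ∀ A : Finset α, A.card = k → b ∉ A → A ∈ L := by
      intro A hAk hbA
      obtain ⟨-, u, hu⟩ := hcard_lt A hAk
      have h1 := hexch A u b hAk hu hbA
      have h2 := hQ1 u (fun h => hbA (h ▸ hu))
      rcases h01 A with h | h
      · rcases h01 (insert b (A.erase u)) with h' | h' <;> omega
      · exact h.1
    have hsub : P.filter (fun A => b ∉ A) ⊆ L ∩ P := by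
      intro A hA
      rw [Finset.mem_filter] at hA
      exact Finset.mem_inter.2 ⟨hL A (hPk A hA.1).1 hA.2, hA.1⟩
    have h1 := Finset.card_le_card hsub
    have h2 := Finset.card_filter_add_card_filter_not (s := P) (fun A => b ∈ A)
    have h3 := hstar b
    omega
  push Not at hQ1
  obtain ⟨e, heb, hew⟩ := hQ1
  have hew : w e = w b := (hdich e).resolve_left hew
  obtain ⟨S, hS, hSF⟩ := exists_card_eq_disjoint {a, b, c, e} (m := k - 2) (by
    have := Finset.card_le_four (a := a) (b := b) (c := c) (d := e)
    omega)
  simp only [Finset.disjoint_insert_right, Finset.disjoint_singleton_right] at hSF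
  obtain ⟨haS, hbS, hcS, heS⟩ := hSF
  have hcb : c ≠ b := by
    rintro rfl
    omega
  have h1 := hw (insert c S) a b (by rw [Finset.card_insert_of_notMem hcS]; omega)
    (by simp [haS, hca.symm]) (by simp [hbS, hcb.symm])
  have h2 := hw (insert b S) c e (by rw [Finset.card_insert_of_notMem hbS]; omega)
    (by simp [hcS, hcb]) (by simp [heS, heb])
  rw [Finset.insert_comm c b S] at h2
  rcases h01 (insert a (insert c S)) with h | h <;>
    rcases h01 (insert e (insert b S)) with h' | h' <;> omega
end

section
/- Let Ω be a finite set with |Ω| = n, let k satisfy 1 ≤ k and 2k ≤ n, and let C be the incidence matrix of elements versus k-subsets of Ω, viewed as a matrix over ℚ. Then the rank of C equals n. -/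
/-- A function on a finite type whose sum over every `k`-subset vanishes is zero,
provided that `0 < k < card α`. -/
theorem eq_zero_of_forall_sum_eq_zero {α : Type*} [Fintype α] [DecidableEq α] {k : ℕ}
    (hk : 1 ≤ k) (hkn : k < Fintype.card α) (v : α → ℚ)
    (hv : ∀ A : Finset α, A.card = k → ∑ p ∈ A, v p = 0) : v = 0 := by
  have hconst : ∀ p q, p ≠ q → v p = v q := by
    intro p q hpq
    have hcard : k - 1 ≤ ({p, q}ᶜ : Finset α).card := by
      rw [Finset.card_compl, Finset.card_pair hpq]
      omega
    obtain ⟨S, hS, hSk⟩ := Finset.exists_subset_card_eq hcard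
    have hp : p ∉ S := fun h => by simpa using hS h
    have hq : q ∉ S := fun h => by simpa using hS h
    have h₁ := hv (insert p S) (by rw [Finset.card_insert_of_notMem hp]; omega)
    have h₂ := hv (insert q S) (by rw [Finset.card_insert_of_notMem hq]; omega)
    rw [Finset.sum_insert hp] at h₁
    rw [Finset.sum_insert hq] at h₂
    linarith
  obtain ⟨A, -, hA⟩ := Finset.exists_subset_card_eq (s := (Finset.univ : Finset α)) hkn.le
  funext p
  have hsum := hv A hA
  rw [Finset.sum_congr rfl fun q _ => show v q = v p by
    by_cases h : q = p
    · rw [h]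
    · exact hconst q p h, Finset.sum_const, hA, nsmul_eq_mul] at hsum
  have hk0 : (k : ℚ) ≠ 0 := by exact_mod_cast (by omega : k ≠ 0)
  simpa [hk0] using hsum

theorem stmt_13 {α : Type*} [Fintype α] [DecidableEq α] {n k : ℕ}
    (hn : Fintype.card α = n) (hk1 : 1 ≤ k) (h2k : 2 * k ≤ n)
    (C : Matrix α {A : Finset α // A.card = k} ℚ)
    (hC : ∀ (p : α) (A : {A : Finset α // A.card = k}), C p A = if p ∈ A.1 then 1 else 0) :
    C.rank = n := by
  rw [← hn]
  apply LinearIndependent.rank_matrix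
  rw [Fintype.linearIndependent_iff]
  intro v hv
  refine congrFun (eq_zero_of_forall_sum_eq_zero hk1 (by omega) v fun A hA => ?_)
  simpa [Matrix.row, hC] using congrFun hv ⟨A, hA⟩
end
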